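/- arXiv:2503.06095 — 11 statements merged into one kernel-verified Lean document; each statement's English description precedes it below -/
import Mathlib

section
/- Let M be a matroid on a finite ground set X with rank function rk and rank r = rk(X) ≥ 2. If t is an integer with f_2(M) < r + t ≤ f_1(M), then σ_{r+t}(M) = C(|X|, r+t) − Σ_{H hyperplane of M with |H| > f_2(M)} C(|H|, r+t). In particular, every non-spanning subset of X of size greater than f_2(M) is contained in exactly one hyperplane of M. -/
/-- A matroid on the finite ground set `α` (the ground set is all of `α`),
given by its rank function on finsets, satisfying the rank axioms. -/
structure FinRankMatroid (α : Type*) [DecidableEq α] [Fintype α] where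
  rk : Finset α → ℕ
  rk_le_card : ∀ A : Finset α, rk A ≤ A.card
  rk_mono : ∀ ⦃A B : Finset α⦄, A ⊆ B → rk A ≤ rk B
  rk_submod : ∀ A B : Finset α, rk (A ∪ B) + rk (A ∩ B) ≤ rk A + rk B

variable {α : Type*} [DecidableEq α] [Fintype α]

/-- `F` is a flat of `M`: adding any element outside `F` increases the rank. -/
def FinRankMatroid.IsFlat (M : FinRankMatroid α) (F : Finset α) : Prop :=
  ∀ e ∉ F, M.rk F < M.rk (insert e F)

/-- `H` is a hyperplane of `M`: a flat of rank `r − 1`. -/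
def FinRankMatroid.IsHyperplane (M : FinRankMatroid α) (H : Finset α) : Prop :=
  M.IsFlat H ∧ M.rk H + 1 = M.rk Finset.univ

open scoped Classical in
/-- `f_1(M)`: the maximum size of a hyperplane of `M`. -/
noncomputable def FinRankMatroid.f1 (M : FinRankMatroid α) : ℕ :=
  (Finset.univ.powerset.filter fun H => M.IsHyperplane H).sup Finset.card

open scoped Classical in
/-- `f_2(M)`: the maximum size of a flat of `M` of rank `r − 2`. -/
noncomputable def FinRankMatroid.f2 (M : FinRankMatroid α) : ℕ :=
  (Finset.univ.powerset.filter fun F => M.IsFlat F ∧ M.rk F + 2 = M.rk Finset.univ).sup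
    Finset.card

/-- `σ_t(M)`: the number of spanning sets of `M` with `t` elements. -/
def FinRankMatroid.sigma (M : FinRankMatroid α) (t : ℕ) : ℕ :=
  (Finset.univ.powerset.filter fun A => M.rk A = M.rk Finset.univ ∧ A.card = t).card

theorem FinRankMatroid.rk_insert_le (M : FinRankMatroid α) (e : α) (F : Finset α) :
    M.rk (insert e F) ≤ M.rk F + 1 := by
  have h := M.rk_submod {e} F
  have h' := M.rk_le_card {e}
  rw [Finset.card_singleton] at h'
  rw [Finset.insert_eq]
  omega

theorem FinRankMatroid.exists_flat (M : FinRankMatroid α) (A : Finset α) (k : ℕ)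
    (hA : M.rk A ≤ k) (hk : k ≤ M.rk Finset.univ) :
    ∃ F, A ⊆ F ∧ M.IsFlat F ∧ M.rk F = k := by
  obtain ⟨F, hF, hmax⟩ := Finset.exists_max_image
    (Finset.univ.filter fun F : Finset α => A ⊆ F ∧ M.rk F ≤ k) Finset.card
    ⟨A, by simp [hA]⟩
  simp only [Finset.mem_filter, Finset.mem_univ, true_and] at hF hmax
  have key : ∀ e ∉ F, k < M.rk (insert e F) := by
    intro e he
    by_contra! hle
    have := hmax (insert e F) ⟨hF.1.trans (Finset.subset_insert _ _), hle⟩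
    rw [Finset.card_insert_of_notMem he] at this
    omega
  refine ⟨F, hF.1, fun e he => lt_of_le_of_lt hF.2 (key e he), ?_⟩
  by_cases hu : F = Finset.univ
  · subst hu; omega
  · obtain ⟨e, he⟩ : ∃ e, e ∉ F := by
      by_contra! h
      exact hu (Finset.eq_univ_iff_forall.2 h)
    have := key e he
    have := M.rk_insert_le e F
    omega

theorem FinRankMatroid.inter_card_le (M : FinRankMatroid α) (hr : 2 ≤ M.rk Finset.univ)
    (H K : Finset α) (hH : M.IsHyperplane H) (hK : M.IsHyperplane K) (hne : ¬ K ⊆ H) :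
    (H ∩ K).card ≤ M.f2 := by
  classical
  obtain ⟨e, heK, heH⟩ := Finset.not_subset.1 hne
  have h1 := hH.1 e heH
  have h2 : M.rk (insert e H) ≤ M.rk (H ∪ K) := M.rk_mono (by
    intro x hx
    rcases Finset.mem_insert.1 hx with rfl | hx
    · exact Finset.mem_union_right _ heK
    · exact Finset.mem_union_left _ hx)
  have h3 := M.rk_submod H K
  have h4 := hH.2
  have h5 := hK.2
  obtain ⟨F, hF, hfl, hrk⟩ := M.exists_flat (H ∩ K) (M.rk Finset.univ - 2) (by omega) (by omega)
  refine (Finset.card_le_card hF).trans ?_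
  unfold FinRankMatroid.f2
  exact Finset.le_sup (f := Finset.card) (by
    simp only [Finset.mem_filter, Finset.mem_powerset, Finset.subset_univ, true_and]
    exact ⟨hfl, by omega⟩)

theorem FinRankMatroid.hyp_unique (M : FinRankMatroid α) (hr : 2 ≤ M.rk Finset.univ)
    (A H K : Finset α) (hA : M.f2 < A.card) (hH : M.IsHyperplane H) (hK : M.IsHyperplane K)
    (hAH : A ⊆ H) (hAK : A ⊆ K) : H = K := by
  by_contra hne
  have h0 := Finset.card_le_card (Finset.subset_inter hAH hAK)
  have h0' := Finset.card_le_card (Finset.subset_inter hAK hAH)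
  by_cases h : K ⊆ H
  · have h' : ¬ H ⊆ K := fun h' => hne (h'.antisymm h)
    have := M.inter_card_le hr K H hK hH h'
    omega
  · have := M.inter_card_le hr H K hH hK h
    omega

theorem FinRankMatroid.hyp_exists (M : FinRankMatroid α) (hr : 2 ≤ M.rk Finset.univ)
    (A : Finset α) (hA : M.rk A ≠ M.rk Finset.univ) : ∃ H, M.IsHyperplane H ∧ A ⊆ H := by
  have := M.rk_mono (Finset.subset_univ A)
  obtain ⟨F, hF, hfl, hrk⟩ := M.exists_flat A (M.rk Finset.univ - 1) (by omega) (by omega)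
  exact ⟨F, ⟨hfl, by omega⟩, hF⟩

open scoped Classical in
theorem FinRankMatroid.count (M : FinRankMatroid α) (hr : 2 ≤ M.rk Finset.univ) (n : ℕ)
    (hn : M.f2 < n) :
    M.sigma n + ∑ H ∈ Finset.univ.powerset.filter
        (fun H => M.IsHyperplane H ∧ M.f2 < H.card), H.card.choose n
      = (Fintype.card α).choose n := by
  have hS : ∑ H ∈ Finset.univ.powerset.filter
        (fun H => M.IsHyperplane H ∧ M.f2 < H.card), H.card.choose n
      = ((Finset.powersetCard n (Finset.univ : Finset α)).filter
          fun A => ¬ M.rk A = M.rk Finset.univ).card := by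
    have hb : (Finset.powersetCard n (Finset.univ : Finset α)).filter
          (fun A => ¬ M.rk A = M.rk Finset.univ) =
        (Finset.univ.powerset.filter (fun H => M.IsHyperplane H ∧ M.f2 < H.card)).biUnion
          (fun H => Finset.powersetCard n H) := by
      ext A
      simp only [Finset.mem_filter, Finset.mem_powersetCard, Finset.mem_biUnion,
        Finset.mem_powerset, Finset.subset_univ, true_and]
      constructor
      · rintro ⟨hc, hA⟩
        obtain ⟨H, hH, hAH⟩ := M.hyp_exists hr A hA
        have := Finset.card_le_card hAH
        exact ⟨H, ⟨hH, by omega⟩, hAH, hc⟩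
      · rintro ⟨H, ⟨hH, _⟩, hAH, hc⟩
        have := M.rk_mono hAH
        have := hH.2
        exact ⟨hc, by omega⟩
    rw [hb, Finset.card_biUnion]
    · simp [Finset.card_powersetCard]
    · intro H hH K hK hne
      have hH := (Finset.mem_filter.1 (Finset.mem_coe.1 hH))
      have hK := (Finset.mem_filter.1 (Finset.mem_coe.1 hK))
      rw [Function.onFun, Finset.disjoint_left]
      intro A hA hA'
      rw [Finset.mem_powersetCard] at hA hA'
      exact hne (M.hyp_unique hr A H K (by omega) hH.2.1 hK.2.1 hA.1 hA'.1)
  have hσ : M.sigma n = ((Finset.powersetCard n (Finset.univ : Finset α)).filter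
          fun A => M.rk A = M.rk Finset.univ).card := by
    unfold FinRankMatroid.sigma
    congr 1
    ext A
    simp only [Finset.mem_filter, Finset.mem_powersetCard,
        Finset.mem_powerset, Finset.subset_univ, true_and]
    exact and_comm
  rw [hS, hσ, Finset.card_filter_add_card_filter_not, Finset.card_powersetCard,
    Finset.card_univ]

open scoped Classical in
/-- If `r ≥ 2` and `t` is an integer with `f_2(M) < r + t ≤ f_1(M)`, then
`σ_{r+t}(M) = C(|X|, r+t) − Σ_{H hyperplane, |H| > f_2(M)} C(|H|, r+t)`; in particular,
every non-spanning subset of `X` of size greater than `f_2(M)` is contained in exactly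
one hyperplane of `M`. -/
theorem stmt_4 (M : FinRankMatroid α) (hr : 2 ≤ M.rk Finset.univ) (t : ℤ)
    (h1 : (M.f2 : ℤ) < (M.rk Finset.univ : ℤ) + t)
    (h2 : (M.rk Finset.univ : ℤ) + t ≤ (M.f1 : ℤ)) :
    (M.sigma ((M.rk Finset.univ : ℤ) + t).toNat : ℤ) =
        ((Fintype.card α).choose ((M.rk Finset.univ : ℤ) + t).toNat : ℤ) -
          ∑ H ∈ Finset.univ.powerset.filter
              (fun H => M.IsHyperplane H ∧ M.f2 < H.card),
            (H.card.choose ((M.rk Finset.univ : ℤ) + t).toNat : ℤ) ∧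
      ∀ A : Finset α, M.f2 < A.card → M.rk A ≠ M.rk Finset.univ →
        ∃! H : Finset α, M.IsHyperplane H ∧ A ⊆ H := by
  refine ⟨?_, ?_⟩
  · have h := M.count hr ((M.rk Finset.univ : ℤ) + t).toNat (by omega)
    rw [← h]
    push_cast
    ring
  · intro A hA hns
    obtain ⟨H, hH, hAH⟩ := M.hyp_exists hr A hns
    exact ⟨H, ⟨hH, hAH⟩, fun K hK => M.hyp_unique hr A K H hA hK.1 hH hK.2 hAH⟩
end

section
/- Let M be a matroid on a finite ground set X with rank function rk and rank r = rk(X) ≥ 2. Then for every natural number j with j > f_2(M) − r (i.e., j + r > f_2(M)), the coefficient of y^j in T_M(1,y) equals C(|X|−j−1, r−1) − Σ_{H hyperplane of M with |H| > f_2(M)} C(|H|−j−1, r−1). -/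
variable {α : Type*} [DecidableEq α] [Fintype α]

/-- `T_M(1, y)` as an integer polynomial in `y`:
`T_M(1,y) = Σ_{A spanning} (y − 1)^{|A| − r}`. -/
noncomputable def FinRankMatroid.tutteOneY (M : FinRankMatroid α) : Polynomial ℤ :=
  ∑ A ∈ Finset.univ.powerset.filter (fun A => M.rk A = M.rk Finset.univ),
    (Polynomial.X - 1) ^ (A.card - M.rk Finset.univ)

open Polynomial in
/-- weight -/
noncomputable def wt5 (j r k : ℕ) : ℤ :=
  if r ≤ k then (((X : ℤ[X]) - 1) ^ (k - r)).coeff j else 0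

theorem wt5_succ (j r k : ℕ) : wt5 j (r+1) (k+1) = wt5 j r k := by
  simp [wt5]

theorem wt5_zero {j r k : ℕ} (h : k < r + j) : wt5 j r k = 0 := by
  unfold wt5
  split_ifs with h1
  · apply Polynomial.coeff_eq_zero_of_natDegree_lt
    have : (((Polynomial.X : Polynomial ℤ) - 1) ^ (k - r)).natDegree ≤ k - r := by
      refine (Polynomial.natDegree_pow_le).trans ?_
      have : ((Polynomial.X : Polynomial ℤ) - 1).natDegree = 1 := by
        simpa using Polynomial.natDegree_X_sub_C (1 : ℤ)
      simp [this]
    omega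
  · rfl

theorem wt5_sum_zero {β : Type*} [DecidableEq β] (j : ℕ) (s : Finset β) :
    ∑ A ∈ s.powerset, wt5 j 0 A.card = if j = s.card then 1 else 0 := by
  have h : (∑ A ∈ s.powerset, ((Polynomial.X : Polynomial ℤ) - 1) ^ A.card) =
      Polynomial.X ^ s.card := by
    have := Finset.prod_add (fun _ : β => (Polynomial.X : Polynomial ℤ) - 1) (fun _ => 1) s
    simp at this
    exact this.symm
  have h2 := congrArg (fun p => Polynomial.coeff p j) h
  simp only [Polynomial.finsetSum_coeff, Polynomial.coeff_X_pow] at h2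
  simpa [wt5] using h2

theorem wt5_sum {β : Type*} [DecidableEq β] (j : ℕ) (s : Finset β) : ∀ r : ℕ,
    ∑ A ∈ s.powerset, wt5 j (r+1) A.card =
      if j < s.card then ((s.card - j - 1).choose r : ℤ) else 0 := by
  induction s using Finset.induction_on with
  | empty => intro r; simp [wt5]
  | insert a s ha ih =>
    intro r
    rw [Finset.sum_powerset_insert ha, ih r]
    have : ∑ t ∈ s.powerset, wt5 j (r+1) (insert a t).card = ∑ t ∈ s.powerset, wt5 j r t.card := by
      refine Finset.sum_congr rfl fun t ht => ?_
      rw [Finset.card_insert_of_notMem (fun h => ha (Finset.mem_powerset.1 ht h)), wt5_succ]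
    rw [this, Finset.card_insert_of_notMem ha]
    cases r with
    | zero =>
      rw [wt5_sum_zero]
      rcases lt_trichotomy j s.card with h | h | h
      · rw [if_pos h, if_neg (by omega), if_pos (by omega)]; simp
      · rw [if_neg (by omega), if_pos h, if_pos (by omega)]; simp
      · rw [if_neg (by omega), if_neg (by omega), if_neg (by omega)]; simp
    | succ r =>
      rw [ih r]
      generalize s.card = n
      rcases lt_trichotomy j n with h | h | h
      · obtain ⟨d, rfl⟩ := Nat.exists_eq_add_of_lt h
        have e1 : j + d + 1 - j - 1 = d := by omega
        have e2 : j + d + 1 + 1 - j - 1 = d + 1 := by omega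
        rw [if_pos h, if_pos h, if_pos (by omega), e1, e2, Nat.choose_succ_succ]
        push_cast; ring
      · subst h; simp
      · rw [if_neg (by omega), if_neg (by omega), if_neg (by omega)]; simp

theorem wt5_sum' {β : Type*} [DecidableEq β] (j : ℕ) (s : Finset β) (r : ℕ) (hr : 2 ≤ r) :
    ∑ A ∈ s.powerset, wt5 j r A.card = ((s.card - j - 1).choose (r - 1) : ℤ) := by
  obtain ⟨r, rfl⟩ := Nat.exists_eq_add_of_le' hr
  rw [wt5_sum j s (r+1)]
  split_ifs with h
  · rfl
  · have : s.card - j - 1 = 0 := by omega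
    simp [this]

theorem FinRankMatroid.exists_flat5 (M : FinRankMatroid α) (A : Finset α) (k : ℕ)
    (h : M.rk A + k ≤ M.rk Finset.univ) :
    ∃ F, A ⊆ F ∧ M.IsFlat F ∧ M.rk F + k = M.rk Finset.univ := by
  obtain ⟨B, hAB, hB⟩ := (Set.toFinite {B : Finset α | M.rk B + k ≤ M.rk Finset.univ}).exists_le_maximal
    (show A ∈ _ from h)
  have hmax : ∀ e ∉ B, M.rk Finset.univ < M.rk (insert e B) + k := by
    intro e he
    by_contra hc
    exact he (hB.2 (show insert e B ∈ _ from not_lt.1 hc) (Finset.subset_insert e B)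
      (Finset.mem_insert_self e B))
  have hB1 : M.rk B + k ≤ M.rk Finset.univ := hB.1
  refine ⟨B, hAB, fun e he => ?_, ?_⟩
  · have := hmax e he; omega
  · by_contra hne
    have : ∃ e, e ∉ B := by
      by_contra hc
      push Not at hc
      have : B = Finset.univ := by ext; simp [hc]
      subst this
      omega
    obtain ⟨e, he⟩ := this
    have h1 := hmax e he
    have h2 := M.rk_submod B {e}
    have h3 := M.rk_le_card {e}
    have h4 : B ∪ {e} = insert e B := by ext; simp [or_comm]
    rw [h4] at h2
    simp at h3
    omega

theorem FinRankMatroid.card_le_f25 (M : FinRankMatroid α) (A : Finset α)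
    (h : M.rk A + 2 ≤ M.rk Finset.univ) : A.card ≤ M.f2 := by
  classical
  obtain ⟨F, hAF, hF⟩ := M.exists_flat5 A 2 h
  refine (Finset.card_le_card hAF).trans ?_
  unfold FinRankMatroid.f2
  exact Finset.le_sup (f := Finset.card) (by simpa using hF)

theorem FinRankMatroid.hyp_unique5 (M : FinRankMatroid α) (A H K : Finset α)
    (hA : M.f2 < A.card) (hH : M.IsHyperplane H) (hK : M.IsHyperplane K)
    (hAH : A ⊆ H) (hAK : A ⊆ K) : K ⊆ H := by
  intro e he
  by_contra hc
  have h1 := hH.1 e hc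
  have h2 := M.rk_submod H K
  have h3 : M.rk (insert e H) ≤ M.rk (H ∪ K) := M.rk_mono (by
    intro x hx
    rcases Finset.mem_insert.1 hx with rfl | hx <;> simp [*])
  have h4 : ¬ (M.rk A + 2 ≤ M.rk Finset.univ) := fun h => by
    have := M.card_le_f25 A h; omega
  have h5 : M.rk A ≤ M.rk (H ∩ K) := M.rk_mono (Finset.subset_inter hAH hAK)
  have := hH.2
  have := hK.2
  omega

open scoped Classical in
/-- If `r ≥ 2`, then for every natural number `j` with `j + r > f_2(M)`,
`[y^j] T_M(1,y) = C(|X|−j−1, r−1) − Σ_{H hyperplane, |H| > f_2(M)} C(|H|−j−1, r−1)`. -/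
theorem stmt_5 (M : FinRankMatroid α) (hr : 2 ≤ M.rk Finset.univ) (j : ℕ)
    (hj : M.f2 < j + M.rk Finset.univ) :
    (M.tutteOneY).coeff j =
      ((Fintype.card α - j - 1).choose (M.rk Finset.univ - 1) : ℤ) -
        ∑ H ∈ Finset.univ.powerset.filter
            (fun H => M.IsHyperplane H ∧ M.f2 < H.card),
          ((H.card - j - 1).choose (M.rk Finset.univ - 1) : ℤ) := by
  have hT : M.tutteOneY.coeff j =
      ∑ A ∈ Finset.univ.powerset.filter (fun A => M.rk A = M.rk Finset.univ),
        wt5 j (M.rk Finset.univ) A.card := by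
    unfold FinRankMatroid.tutteOneY
    rw [Polynomial.finsetSum_coeff]
    refine Finset.sum_congr rfl fun A hA => ?_
    have h1 := (Finset.mem_filter.1 hA).2
    have h2 := M.rk_le_card A
    rw [wt5, if_pos (by omega)]
  have hX := wt5_sum' j (Finset.univ : Finset α) (M.rk Finset.univ) hr
  rw [Finset.card_univ] at hX
  rw [hT, ← hX, eq_sub_iff_add_eq, Finset.sum_filter]
  simp_rw [← wt5_sum' j _ (M.rk Finset.univ) hr]
  have hsw : ∀ H : Finset α, ∑ A ∈ H.powerset, wt5 j (M.rk Finset.univ) A.card =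
      ∑ A ∈ (Finset.univ : Finset α).powerset,
        if A ⊆ H then wt5 j (M.rk Finset.univ) A.card else 0 := by
    intro H
    rw [← Finset.sum_filter]
    refine Finset.sum_congr ?_ fun _ _ => rfl
    ext; simp
  simp_rw [hsw]
  rw [Finset.sum_comm, ← Finset.sum_add_distrib]
  refine Finset.sum_congr rfl fun A _ => ?_
  rw [if_pos (Finset.subset_univ A)]
  by_cases hc : A.card < M.rk Finset.univ + j
  · simp [wt5_zero hc]
  have hA : M.f2 < A.card := by omega
  split_ifs with hs
  · rw [Finset.sum_eq_zero, add_zero]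
    intro H hH
    rw [if_neg]
    intro hAH
    have h1 := M.rk_mono hAH
    have h2 := (Finset.mem_filter.1 hH).2.1.2
    omega
  · have h1 := M.rk_mono (Finset.subset_univ A)
    obtain ⟨H, hAH, hH⟩ := M.exists_flat5 A 1 (by omega)
    have hcard := Finset.card_le_card hAH
    rw [zero_add, Finset.sum_eq_single H, if_pos hAH]
    · intro K hK hne
      rw [if_neg]
      intro hAK
      have hK' := (Finset.mem_filter.1 hK).2.1
      exact hne (Finset.Subset.antisymm (M.hyp_unique5 A H K hA hH hK' hAH hAK)
        (M.hyp_unique5 A K H hA hK' hH hAK hAH))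
    · intro hn
      exact absurd (Finset.mem_filter.2 ⟨by simp, hH, by omega⟩) hn
end

section
/- Let M be a matroid on a finite ground set X with rank function rk and rank r = rk(X) ≥ 2. Then for every natural number j with j + r > f_2(M), the coefficient of y^j in T_M(1,y) equals C(|X|−j−1, r−1) − Σ_{C cocircuit of M with |C| < |X| − f_2(M)} C(|X|−|C|−j−1, r−1). -/
variable {α : Type*} [DecidableEq α] [Fintype α]

/-- `C` is a cocircuit of `M`: a circuit of the dual matroid, equivalently the
complement `X ∖ H` of a hyperplane `H` of `M`. -/
def FinRankMatroid.IsCocircuit (M : FinRankMatroid α) (C : Finset α) : Prop :=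
  ∃ H : Finset α, M.IsHyperplane H ∧ C = Finset.univ \ H

open Polynomial in
theorem aux_coeff (S : Finset α) : ∀ (r j : ℕ),
    (∑ A ∈ S.powerset, if r + 1 ≤ A.card then ((X - 1 : ℤ[X]) ^ (A.card - (r + 1))).coeff j else 0)
      = if j < S.card then ((S.card - 1 - j).choose r : ℤ) else 0 := by
  induction S using Finset.induction_on with
  | empty => intro r j; simp
  | insert a S ha ih =>
    intro r j
    rw [Finset.sum_powerset_insert ha, ih, Finset.card_insert_of_notMem ha]
    have h1 : ∀ A ∈ S.powerset, (insert a A).card = A.card + 1 := by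
      intro A hA
      rw [Finset.card_insert_of_notMem]
      intro h
      exact ha (Finset.mem_powerset.1 hA h)
    cases r with
    | zero =>
      have h2 : (∑ A ∈ S.powerset, if 0 + 1 ≤ (insert a A).card then
          ((X - 1 : ℤ[X]) ^ ((insert a A).card - (0 + 1))).coeff j else 0)
          = (X ^ S.card : ℤ[X]).coeff j := by
        have h3 : (X ^ S.card : ℤ[X]) = ∑ A ∈ S.powerset, (X - 1 : ℤ[X]) ^ A.card := by
          have := Finset.sum_pow_mul_eq_add_pow (X - 1 : ℤ[X]) 1 S
          simpa using this.symm
        rw [h3, finset_sum_coeff]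
        apply Finset.sum_congr rfl
        intro A hA
        rw [h1 A hA]
        simp
      rw [h2, coeff_X_pow]
      simp only [Nat.choose_zero_right]
      split_ifs <;> first | omega | simp
    | succ r =>
      have h2 : (∑ A ∈ S.powerset, if r + 1 + 1 ≤ (insert a A).card then
          ((X - 1 : ℤ[X]) ^ ((insert a A).card - (r + 1 + 1))).coeff j else 0)
          = if j < S.card then ((S.card - 1 - j).choose r : ℤ) else 0 := by
        rw [← ih]
        apply Finset.sum_congr rfl
        intro A hA
        rw [h1 A hA]
        simp
      rw [h2]
      by_cases hj : j < S.card
      · have h4 : S.card + 1 - 1 - j = (S.card - 1 - j) + 1 := by omega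
        rw [if_pos hj, if_pos hj, if_pos (by omega), h4, Nat.choose_succ_succ]
        push_cast; ring
      · rw [if_neg hj, if_neg hj]
        split_ifs
        · have h4 : S.card + 1 - 1 - j = 0 := by omega
          rw [h4]; simp
        · simp

theorem aux_insert (M : FinRankMatroid α) (F : Finset α) (e : α) :
    M.rk (insert e F) ≤ M.rk F + 1 := by
  have h := M.rk_submod {e} F
  have h1 := M.rk_le_card {e}
  rw [Finset.card_singleton] at h1
  rw [Finset.insert_eq]
  omega

theorem aux_flat (M : FinRankMatroid α) (A : Finset α) (k : ℕ) (h1 : M.rk A ≤ k)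
    (h2 : k ≤ M.rk Finset.univ) : ∃ F, A ⊆ F ∧ M.IsFlat F ∧ M.rk F = k := by
  classical
  obtain ⟨F, hF, hmax⟩ := Finset.exists_max_image
    (Finset.univ.filter fun F : Finset α => A ⊆ F ∧ M.rk F ≤ k) Finset.card
    ⟨A, by simp [h1]⟩
  simp only [Finset.mem_filter, Finset.mem_univ, true_and] at hF hmax
  have key : ∀ e ∉ F, k < M.rk (insert e F) := by
    intro e he
    by_contra hc
    have := hmax (insert e F) ⟨hF.1.trans (Finset.subset_insert _ _), by omega⟩
    rw [Finset.card_insert_of_notMem he] at this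
    omega
  refine ⟨F, hF.1, fun e he => lt_of_le_of_lt hF.2 (key e he), ?_⟩
  by_contra hne
  have hlt : M.rk F < k := lt_of_le_of_ne hF.2 hne
  have : ∃ e, e ∉ F := by
    by_contra hc
    push Not at hc
    rw [Finset.eq_univ_iff_forall.2 hc] at hlt
    omega
  obtain ⟨e, he⟩ := this
  have := key e he
  have := aux_insert M F e
  omega

theorem aux_sub (M : FinRankMatroid α) (A H K : Finset α) (hH : M.IsFlat H)
    (hAH : A ⊆ H) (hAK : A ⊆ K) (h : M.rk K = M.rk A) : K ⊆ H := by
  intro e he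
  by_contra hne
  have h1 := hH e hne
  have h2 := M.rk_submod H K
  have h3 := M.rk_mono (Finset.subset_inter hAH hAK)
  have h4 : M.rk (insert e H) ≤ M.rk (H ∪ K) := M.rk_mono (by
    intro x hx
    rcases Finset.mem_insert.1 hx with rfl | hx
    · exact Finset.mem_union_right _ he
    · exact Finset.mem_union_left _ hx)
  omega

theorem aux_f2 (M : FinRankMatroid α) (hr : 2 ≤ M.rk Finset.univ) (A : Finset α)
    (hA : M.f2 < A.card) : M.rk Finset.univ ≤ M.rk A + 1 := by
  classical
  by_contra hc
  obtain ⟨F, hAF, hF, hk⟩ := aux_flat M A (M.rk Finset.univ - 2) (by omega) (by omega)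
  have h1 : F.card ≤ M.f2 := by
    unfold FinRankMatroid.f2
    apply Finset.le_sup (f := Finset.card)
    simp only [Finset.mem_filter, Finset.powerset_univ, Finset.mem_univ, true_and]
    exact ⟨hF, by omega⟩
  have := Finset.card_le_card hAF
  omega

open scoped Classical in
/-- If `r ≥ 2`, then for every natural number `j` with `j + r > f_2(M)`,
`[y^j] T_M(1,y) = C(|X|−j−1, r−1) − Σ_{C cocircuit, |C| < |X| − f_2(M)} C(|X|−|C|−j−1, r−1)`. -/
theorem stmt_6 (M : FinRankMatroid α) (hr : 2 ≤ M.rk Finset.univ) (j : ℕ)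
    (hj : M.f2 < j + M.rk Finset.univ) :
    (M.tutteOneY).coeff j =
      ((Fintype.card α - j - 1).choose (M.rk Finset.univ - 1) : ℤ) -
        ∑ C ∈ Finset.univ.powerset.filter
            (fun C => M.IsCocircuit C ∧ C.card < Fintype.card α - M.f2),
          ((Fintype.card α - C.card - j - 1).choose (M.rk Finset.univ - 1) : ℤ) := by
  obtain ⟨s, hs⟩ : ∃ s, M.rk Finset.univ = s + 1 + 1 := ⟨M.rk Finset.univ - 2, by omega⟩
  set c : Finset α → ℤ := fun A => if s + 1 + 1 ≤ A.card then
    ((Polynomial.X - 1 : Polynomial ℤ) ^ (A.card - (s + 1 + 1))).coeff j else 0 with hc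
  have hG : ∀ S : Finset α, ((S.card - j - 1).choose (s + 1) : ℤ) = ∑ A ∈ S.powerset, c A := by
    intro S
    rw [hc, aux_coeff]
    split_ifs
    · rw [Nat.sub_right_comm]
    · have : S.card - j - 1 = 0 := by omega
      rw [this]; simp
  have hc0 : ∀ A, A.card < j + (s + 1 + 1) → c A = 0 := by
    intro A hA
    simp only [hc]
    split_ifs with h
    · apply Polynomial.coeff_eq_zero_of_natDegree_lt
      have : ((Polynomial.X - 1 : Polynomial ℤ) ^ (A.card - (s + 1 + 1))).natDegree
          ≤ A.card - (s + 1 + 1) := by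
        refine Polynomial.natDegree_pow_le.trans ?_
        rw [← Polynomial.C_1, Polynomial.natDegree_X_sub_C]
        simp
      omega
    · rfl
  have hL : (M.tutteOneY).coeff j =
      ∑ A ∈ Finset.univ.powerset.filter (fun A => M.rk A = M.rk Finset.univ), c A := by
    unfold FinRankMatroid.tutteOneY
    rw [Polynomial.finset_sum_coeff]
    apply Finset.sum_congr rfl
    intro A hA
    have h1 := (Finset.mem_filter.1 hA).2
    have h2 := M.rk_le_card A
    simp only [hc]
    rw [if_pos (by omega), hs]
  clear_value c
  have hR : ∑ C ∈ Finset.univ.powerset.filter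
            (fun C => M.IsCocircuit C ∧ C.card < Fintype.card α - M.f2),
          ((Fintype.card α - C.card - j - 1).choose (M.rk Finset.univ - 1) : ℤ)
      = ∑ H ∈ Finset.univ.filter (fun H => M.IsHyperplane H ∧ M.f2 < H.card),
          ∑ A ∈ H.powerset, c A := by
    refine Finset.sum_nbij' (fun C => Cᶜ) (fun C => Cᶜ) ?_ ?_ ?_ ?_ ?_
    · intro C hC
      simp only [Finset.mem_filter, Finset.powerset_univ, Finset.mem_univ, true_and] at hC ⊢
      obtain ⟨⟨H, hH, rfl⟩, h2⟩ := hC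
      rw [← Finset.compl_eq_univ_sdiff] at h2 ⊢
      rw [compl_compl]
      refine ⟨hH, ?_⟩
      have := Finset.card_compl_add_card H
      omega
    · intro H hH
      simp only [Finset.mem_filter, Finset.powerset_univ, Finset.mem_univ, true_and] at hH ⊢
      refine ⟨⟨H, hH.1, Finset.compl_eq_univ_sdiff H⟩, ?_⟩
      have := Finset.card_compl_add_card H
      omega
    · intro C _; simp
    · intro C _; simp
    · intro C _
      rw [← hG, Finset.card_compl, hs]
      rfl
  have hT : ((Fintype.card α - j - 1).choose (M.rk Finset.univ - 1) : ℤ)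
      = ∑ A ∈ Finset.univ.powerset, c A := by
    rw [← hG, hs]; rfl
  have hN : ∑ H ∈ Finset.univ.filter (fun H => M.IsHyperplane H ∧ M.f2 < H.card),
          ∑ A ∈ H.powerset, c A
      = ∑ A ∈ Finset.univ.powerset.filter (fun A => ¬ M.rk A = M.rk Finset.univ), c A := by
    have e1 : ∀ H : Finset α, ∑ A ∈ H.powerset, c A
        = ∑ A ∈ Finset.univ.powerset, if A ⊆ H then c A else 0 := by
      intro H
      rw [← Finset.sum_filter]
      apply Finset.sum_congr _ (fun _ _ => rfl)
      ext A; simp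
    simp only [e1]
    rw [Finset.sum_comm, Finset.sum_filter]
    apply Finset.sum_congr rfl
    intro A _
    by_cases hA : A.card < j + (s + 1 + 1)
    · simp [hc0 A hA]
    have hf : M.f2 < A.card := by omega
    have hk := aux_f2 M hr A hf
    have hm := M.rk_mono (Finset.subset_univ A)
    by_cases hsp : ¬ M.rk A = M.rk Finset.univ
    · rw [if_pos hsp]
      obtain ⟨H, hAH, hH, hHk⟩ := aux_flat M A (s + 1) (by omega) (by omega)
      rw [Finset.sum_eq_single H]
      · rw [if_pos hAH]
      · intro K hK hne
        rw [if_neg]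
        intro hAK
        have hK' := (Finset.mem_filter.1 hK).2.1
        have hK2 := hK'.2
        apply hne
        apply Finset.Subset.antisymm
        · exact aux_sub M A H K hH hAH hAK (by omega)
        · exact aux_sub M A K H hK'.1 hAK hAH (by omega)
      · intro hn
        exfalso
        apply hn
        have := Finset.card_le_card hAH
        simp only [Finset.mem_filter, Finset.mem_univ, true_and]
        exact ⟨⟨hH, by omega⟩, by omega⟩
    · rw [if_neg hsp]
      apply Finset.sum_eq_zero
      intro K hK
      rw [if_neg]
      intro hAK
      have hK2 := (Finset.mem_filter.1 hK).2.1.2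
      have := M.rk_mono hAK
      omega
  rw [hL, hR, hT, hN, ← Finset.sum_filter_add_sum_filter_not Finset.univ.powerset
    (fun A => M.rk A = M.rk Finset.univ) c]
  ring
end

section
/- Let M be a matroid on a finite ground set X with rank function rk and rank r = rk(X) ≥ 1. Then for every natural number j with j ≤ |X| − r, the inequality f_1(M) < j + r holds if and only if the coefficient of y^j in T_M(1,y) equals C(|X|−j−1, r−1). -/
variable {α : Type*} [DecidableEq α] [Fintype α]

open Polynomial in
noncomputable def sP (ρ : Finset α → ℕ) (E : Finset α) (r : ℕ) : Polynomial ℤ :=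
  ∑ A ∈ E.powerset, if ρ A = r then (Polynomial.X - 1) ^ (A.card - r) else 0

structure RkAx (ρ : Finset α → ℕ) : Prop where
  le_card : ∀ A : Finset α, ρ A ≤ A.card
  mono : ∀ ⦃A B : Finset α⦄, A ⊆ B → ρ A ≤ ρ B
  submod : ∀ A B : Finset α, ρ (A ∪ B) + ρ (A ∩ B) ≤ ρ A + ρ B

theorem RkAx.insert_le {ρ : Finset α → ℕ} (h : RkAx ρ) (e : α) (A : Finset α) :
    ρ (insert e A) ≤ ρ A + ρ {e} := by
  have := h.submod A {e}
  rw [Finset.union_comm, ← Finset.insert_eq] at this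
  omega

theorem RkAx.contract {ρ : Finset α → ℕ} (h : RkAx ρ) (e : α) (he : ρ {e} = 1) :
    RkAx (fun A => ρ (insert e A) - 1) := by
  have pos : ∀ A : Finset α, 1 ≤ ρ (insert e A) := fun A => by
    rw [← he]; exact h.mono (by simp)
  refine ⟨fun A => ?_, fun A B hAB => ?_, fun A B => ?_⟩
  · have := h.insert_le e A
    have := h.le_card A
    omega
  · exact Nat.sub_le_sub_right (h.mono (Finset.insert_subset_insert e hAB)) 1
  · have h1 := h.submod (insert e A) (insert e B)
    have e1 : insert e A ∪ insert e B = insert e (A ∪ B) := by ext; simp only [Finset.mem_union, Finset.mem_inter, Finset.mem_insert]; tauto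
    have e2 : insert e A ∩ insert e B = insert e (A ∩ B) := by ext; simp only [Finset.mem_union, Finset.mem_inter, Finset.mem_insert]; tauto
    rw [e1, e2] at h1
    have := pos A
    have := pos B
    have := pos (A ∪ B)
    have := pos (A ∩ B)
    omega

theorem sP_insert (ρ : Finset α → ℕ) (E : Finset α) (e : α) (he : e ∉ E) (r : ℕ) :
    sP ρ (insert e E) r = sP ρ E r +
      ∑ A ∈ E.powerset, if ρ (insert e A) = r then (Polynomial.X - 1) ^ (A.card + 1 - r) else 0 := by
  unfold sP
  rw [Finset.sum_powerset_insert he]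
  congr 1
  refine Finset.sum_congr rfl fun A hA => ?_
  rw [Finset.card_insert_of_notMem (fun h => he (Finset.mem_powerset.1 hA h))]

theorem sP_nonloop (ρ : Finset α → ℕ) (h : RkAx ρ) (E : Finset α) (e : α) (he : e ∉ E)
    (r : ℕ) (h1 : ρ {e} = 1) :
    sP ρ (insert e E) (r + 1) = sP ρ E (r + 1) + sP (fun A => ρ (insert e A) - 1) E r := by
  rw [sP_insert ρ E e he]
  congr 1
  unfold sP
  refine Finset.sum_congr rfl fun A hA => ?_
  have pos : 1 ≤ ρ (insert e A) := by
    rw [← h1]; exact h.mono (by simp)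
  have : (ρ (insert e A) = r + 1) ↔ (ρ (insert e A) - 1 = r) := by omega
  simp only [this, Nat.add_sub_add_right]

theorem sP_loop (ρ : Finset α → ℕ) (h : RkAx ρ) (E : Finset α) (e : α) (he : e ∉ E)
    (r : ℕ) (h1 : ρ {e} = 0) :
    sP ρ (insert e E) r = Polynomial.X * sP ρ E r := by
  rw [sP_insert ρ E e he]
  unfold sP
  rw [← Finset.sum_add_distrib, Finset.mul_sum]
  refine Finset.sum_congr rfl fun A hA => ?_
  have e1 : ρ (insert e A) = ρ A := by
    have := h.insert_le e A
    have := h.mono (Finset.subset_insert e A)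
    omega
  rw [e1]
  split_ifs with h2
  · have := h.le_card A
    rw [show A.card + 1 - r = (A.card - r) + 1 by omega, pow_succ]
    ring
  · simp

theorem sP_coeff_zero (ρ : Finset α → ℕ) (E : Finset α) (r j : ℕ) (hj : E.card < j + r)
    (h0 : 0 < j) : (sP ρ E r).coeff j = 0 := by
  unfold sP
  rw [Polynomial.finsetSum_coeff]
  refine Finset.sum_eq_zero fun A hA => ?_
  split_ifs
  · apply Polynomial.coeff_eq_zero_of_natDegree_lt
    have hc := Finset.card_le_card (Finset.mem_powerset.1 hA)
    have : ((Polynomial.X - 1 : Polynomial ℤ) ^ (A.card - r)).natDegree ≤ (A.card - r) * 1 :=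
      Polynomial.natDegree_pow_le_of_le _ (by
        have := Polynomial.natDegree_X_sub_C_le (1 : ℤ)
        simpa using this)
    omega
  · simp

theorem sP_empty_of_lt (ρ : Finset α → ℕ) (h : RkAx ρ) (E : Finset α) (r : ℕ) (hr : ρ E < r) :
    sP ρ E r = 0 := by
  refine Finset.sum_eq_zero fun A hA => ?_
  have := h.mono (Finset.mem_powerset.1 hA)
  rw [if_neg (by omega)]

theorem main_ind (E : Finset α) : ∀ (ρ : Finset α → ℕ), RkAx ρ → ∀ r i j : ℕ, ρ E = r →
    j + r + i = E.card →
    (sP ρ E r).coeff j ≤ (Nat.multichoose r i : ℤ) ∧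
    ((sP ρ E r).coeff j = (Nat.multichoose r i : ℤ) ↔
      ∀ N ⊆ E, ρ N < r → N.card < j + r) := by
  induction E using Finset.induction_on with
  | empty =>
    intro ρ h r i j hr hc
    simp only [Finset.card_empty] at hc
    obtain rfl : r = 0 := by omega
    obtain rfl : i = 0 := by omega
    obtain rfl : j = 0 := by omega
    simp [sP, hr]
  | insert e E he ih =>
    intro ρ h r i j hr hc
    rw [Finset.card_insert_of_notMem he] at hc
    have hle := h.insert_le e E
    have hmono := h.mono (Finset.subset_insert e E)
    have hle1 := h.le_card {e}
    rw [Finset.card_singleton] at hle1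
    rcases Nat.eq_zero_or_pos (ρ {e}) with h1 | h1
    · have hE : ρ E = r := by omega
      rw [sP_loop ρ h E e he r h1]
      cases j with
      | zero =>
        rw [Polynomial.coeff_X_mul_zero]
        refine ⟨by positivity, ?_⟩
        have hEc := h.le_card E
        cases r with
        | zero =>
          obtain ⟨k, rfl⟩ : ∃ k, i = k + 1 := ⟨i - 1, by omega⟩
          simp
        | succ r =>
          constructor
          · intro hh
            have : Nat.multichoose (r+1) i ≠ 0 := by
              rw [Nat.multichoose_eq]
              exact (Nat.choose_pos (by omega)).ne'
            exact absurd hh.symm (by exact_mod_cast this)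
          · intro hN
            exfalso
            obtain ⟨N, hNE, hNc⟩ := Finset.exists_subset_card_eq (s := E) (n := r) (by omega)
            have h2 := h.insert_le e N
            have h3 := h.le_card N
            have h4 := hN (insert e N) (Finset.insert_subset_insert e hNE) (by omega)
            rw [Finset.card_insert_of_notMem (fun h => he (hNE h))] at h4
            omega
      | succ j =>
        rw [Polynomial.coeff_X_mul]
        obtain ⟨ih1, ih2⟩ := ih ρ h r i j hE (by omega)
        refine ⟨ih1, ih2.trans ⟨fun H N hN hlt => ?_, fun H N hN hlt => ?_⟩⟩
        · have := H (N.erase e) (by rwa [Finset.subset_insert_iff] at hN)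
            ((h.mono (Finset.erase_subset e N)).trans_lt hlt)
          have := Finset.pred_card_le_card_erase (s := N) (a := e)
          omega
        · have h2 := h.insert_le e N
          have := H (insert e N) (Finset.insert_subset_insert e hN) (by omega)
          rw [Finset.card_insert_of_notMem (fun h => he (hN h))] at this
          omega
    · have h1 : ρ {e} = 1 := by omega
      have hpos : 1 ≤ r := by
        rw [← hr, ← h1]; exact h.mono (by simp)
      obtain ⟨r, rfl⟩ : ∃ k, r = k + 1 := ⟨r - 1, by omega⟩
      rw [sP_nonloop ρ h E e he r h1, Polynomial.coeff_add]
      obtain ⟨ic1, ic2⟩ := ih _ (h.contract e h1) r i j (by omega) (by omega)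
      have hcon : ∀ N : Finset α, ρ (insert e N) - 1 < r ↔ ρ (insert e N) < r + 1 := by
        intro N
        have : 1 ≤ ρ (insert e N) := by rw [← h1]; exact h.mono (by simp)
        omega
      simp only [hcon] at ic2
      cases i with
      | zero =>
        have hz : (sP ρ E (r+1)).coeff j = 0 := by
          rcases Nat.eq_zero_or_pos j with hj | hj
          · have := h.le_card E
            rw [sP_empty_of_lt ρ h E _ (by omega)]; simp
          · exact sP_coeff_zero ρ E _ _ (by omega) hj
        rw [hz, zero_add]
        simp only [Nat.multichoose_zero_right] at *
        refine ⟨ic1, iff_of_true (ic2.2 fun N hN hlt => ?_) fun N hN hlt => ?_⟩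
        · have : N ≠ E := by rintro rfl; omega
          have := Finset.card_lt_card (hN.ssubset_of_ne this)
          omega
        · have : N ≠ insert e E := by rintro rfl; omega
          have := Finset.card_lt_card (hN.ssubset_of_ne this)
          rw [Finset.card_insert_of_notMem he] at this
          omega
      | succ i =>
        rw [Nat.multichoose_succ_succ]
        push_cast
        by_cases hco : ρ E = r + 1
        · obtain ⟨id1, id2⟩ := ih ρ h (r+1) i j hco (by omega)
          refine ⟨by linarith, ?_⟩
          have : ((sP ρ E (r + 1)).coeff j + (sP (fun A => ρ (insert e A) - 1) E r).coeff j =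
              (Nat.multichoose r (i+1) : ℤ) + (Nat.multichoose (r+1) i : ℤ)) ↔
              ((sP ρ E (r + 1)).coeff j = (Nat.multichoose (r+1) i : ℤ) ∧
               (sP (fun A => ρ (insert e A) - 1) E r).coeff j = (Nat.multichoose r (i+1) : ℤ)) := by
            constructor
            · intro; constructor <;> linarith
            · rintro ⟨a, b⟩; linarith
          rw [this, id2, ic2]
          constructor
          · rintro ⟨a, b⟩ N hN hlt
            by_cases heN : e ∈ N
            · have := b (N.erase e) (by rwa [Finset.subset_insert_iff] at hN)
                (by rwa [Finset.insert_erase heN])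
              have := Finset.card_erase_add_one heN
              omega
            · exact a N ((Finset.subset_insert_iff_of_notMem heN).1 hN) hlt
          · intro H
            refine ⟨fun N hN hlt => H N (hN.trans (Finset.subset_insert e E)) hlt,
              fun N hN hlt => ?_⟩
            have := H (insert e N) (Finset.insert_subset_insert e hN) hlt
            rw [Finset.card_insert_of_notMem (fun h => he (hN h))] at this
            omega
        · rw [sP_empty_of_lt ρ h E _ (by omega), Polynomial.coeff_zero, zero_add]
          have hp : 0 < (Nat.multichoose (r+1) i : ℤ) := by
            have : 0 < Nat.multichoose (r+1) i := by
              rw [Nat.multichoose_eq]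
              exact Nat.choose_pos (by omega)
            exact_mod_cast this
          refine ⟨by linarith, iff_of_false (by intro; linarith) fun H => ?_⟩
          have := H E (Finset.subset_insert e E) (by omega)
          omega

theorem f1_lt_iff (M : FinRankMatroid α) (hr : 1 ≤ M.rk Finset.univ) (m : ℕ) (hm : 0 < m) :
    M.f1 < m ↔ ∀ N ⊆ (Finset.univ : Finset α), M.rk N < M.rk Finset.univ → N.card < m := by
  classical
  have h : RkAx M.rk := ⟨M.rk_le_card, M.rk_mono, M.rk_submod⟩
  unfold FinRankMatroid.f1
  rw [Finset.sup_lt_iff (by simpa using hm)]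
  constructor
  · intro H N _ hN
    obtain ⟨K, hK, hmax⟩ := Finset.exists_max_image
      (Finset.univ.filter fun K : Finset α => N ⊆ K ∧ M.rk K < M.rk Finset.univ) Finset.card
      ⟨N, by simp [hN]⟩
    simp only [Finset.mem_filter, Finset.mem_univ, true_and] at hK hmax
    have key : ∀ e ∉ K, M.rk Finset.univ ≤ M.rk (insert e K) := by
      intro e he
      by_contra hlt
      have := hmax (insert e K) ⟨hK.1.trans (Finset.subset_insert e K), by omega⟩
      rw [Finset.card_insert_of_notMem he] at this
      omega
    have hyp : M.IsHyperplane K := by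
      refine ⟨fun e he => hK.2.trans_le (key e he), ?_⟩
      obtain ⟨e, he⟩ : ∃ e, e ∉ K := by
        by_contra! hall
        rw [Finset.eq_univ_iff_forall.2 hall] at hK
        exact lt_irrefl _ hK.2
      have h1 := key e he
      have h2 := h.insert_le e K
      have h3 := h.le_card {e}
      rw [Finset.card_singleton] at h3
      omega
    exact (Finset.card_le_card hK.1).trans_lt (H K (by simp [hyp]))
  · intro H K hK
    have hK : M.IsHyperplane K := by simpa using hK
    exact H K (Finset.subset_univ _) (by have := hK.2; omega)

/-- If `r ≥ 1`, then for every natural number `j ≤ |X| − r`, we have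
`f_1(M) < j + r` if and only if `[y^j] T_M(1,y) = C(|X|−j−1, r−1)`. -/
theorem stmt_7 (M : FinRankMatroid α) (hr : 1 ≤ M.rk Finset.univ) (j : ℕ)
    (hj : j ≤ Fintype.card α - M.rk Finset.univ) :
    M.f1 < j + M.rk Finset.univ ↔
      (M.tutteOneY).coeff j =
        ((Fintype.card α - j - 1).choose (M.rk Finset.univ - 1) : ℤ) := by
  have h : RkAx M.rk := ⟨M.rk_le_card, M.rk_mono, M.rk_submod⟩
  have hc := M.rk_le_card Finset.univ
  rw [Finset.card_univ] at hc
  rw [f1_lt_iff M hr _ (by omega)]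
  have := (main_ind Finset.univ M.rk h (M.rk Finset.univ)
    (Fintype.card α - M.rk Finset.univ - j) j rfl (by rw [Finset.card_univ]; omega)).2
  rw [← this]
  have e1 : sP M.rk Finset.univ (M.rk Finset.univ) = M.tutteOneY := by
    unfold sP FinRankMatroid.tutteOneY
    rw [Finset.sum_filter]
  have e2 : Nat.multichoose (M.rk Finset.univ) (Fintype.card α - M.rk Finset.univ - j) =
      (Fintype.card α - j - 1).choose (M.rk Finset.univ - 1) := by
    rw [Nat.multichoose_eq]
    rw [← Nat.choose_symm_of_eq_add (n := Fintype.card α - j - 1) (a := Fintype.card α - M.rk Finset.univ - j) (by omega)]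
    congr 1
    omega
  rw [e1, e2]
end

section
/- Let M be a matroid on a finite ground set X with rank function rk and rank r = rk(X), and suppose there exists at least one set A ∈ D(M) with rk(A) = |A| − 2, so that d_2(M) is well defined. Then for every natural number i with i > r − d_2(M) (i.e., i + d_2(M) > r), the coefficient of x^i in T_M(x,1) equals C(|X|−i−1, r−i) − Σ_{C circuit of M with |C| < d_2(M)} C(|X|−|C|−i−1, |X|−r−1). -/
variable {α : Type*} [DecidableEq α] [Fintype α]

/-- `C` is a circuit of `M`: a minimal dependent set, i.e. a nonempty set with
`rk(C) = |C| − 1` and `rk(C ∖ {e}) = rk(C)` for every `e ∈ C`. -/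
def FinRankMatroid.IsCircuit (M : FinRankMatroid α) (C : Finset α) : Prop :=
  C.Nonempty ∧ M.rk C + 1 = C.card ∧ ∀ e ∈ C, M.rk (C.erase e) = M.rk C

/-- `A ∈ D(M)`: `rk(A ∖ {e}) = rk(A)` for every `e ∈ A`. -/
def FinRankMatroid.InDualFlatFamily (M : FinRankMatroid α) (A : Finset α) : Prop :=
  ∀ e ∈ A, M.rk (A.erase e) = M.rk A

/-- `T_M(x, 1)` as an integer polynomial in `x`:
`T_M(x,1) = Σ_{A independent} (x − 1)^{r − |A|}`. -/
noncomputable def FinRankMatroid.tutteXOne (M : FinRankMatroid α) : Polynomial ℤ :=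
  ∑ A ∈ Finset.univ.powerset.filter (fun A => M.rk A = A.card),
    (Polynomial.X - 1) ^ (M.rk Finset.univ - A.card)

/-- The binomial coefficient `C(a, b)` for integer arguments, with the convention
that `C(a, b) = 0` when `b < 0` or `b > a`. -/
def zchoose (a b : ℤ) : ℤ :=
  if 0 ≤ b ∧ b ≤ a then (a.toNat.choose b.toNat : ℤ) else 0

theorem aux_coeff_s8 (i : ℕ) : ∀ N m : ℕ,
    ∑ k ∈ Finset.range (m + i + 1), ((N + i + 1).choose k : ℤ) *
      ((Polynomial.X - 1 : Polynomial ℤ) ^ (m + i - k)).coeff i = (N.choose m : ℤ) := by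
  have key : ∀ N m : ℕ, ∀ y : Polynomial ℤ, ∑ k ∈ Finset.range (m + 2), ((N + 1).choose k : Polynomial ℤ) * y ^ (m + 1 - k)
      = (y + 1) * ∑ k ∈ Finset.range (m + 1), (N.choose k : Polynomial ℤ) * y ^ (m - k)
        + (N.choose (m + 1) : Polynomial ℤ) := by
    intro N m y
    have e1 : ∑ k ∈ Finset.range (m + 2), (N.choose k : Polynomial ℤ) * y ^ (m + 1 - k)
        = y * ∑ k ∈ Finset.range (m + 1), (N.choose k : Polynomial ℤ) * y ^ (m - k)
          + (N.choose (m + 1) : Polynomial ℤ) := by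
      rw [Finset.sum_range_succ, Finset.mul_sum]
      congr 1
      · apply Finset.sum_congr rfl
        intro k hk
        have : k < m + 1 := Finset.mem_range.mp hk
        rw [show m + 1 - k = (m - k) + 1 by omega]
        ring
      · simp
    have e2 : ∑ k ∈ Finset.range (m + 2), ((N + 1).choose k : Polynomial ℤ) * y ^ (m + 1 - k)
        = ∑ k ∈ Finset.range (m + 1), (N.choose k : Polynomial ℤ) * y ^ (m - k) +
          ∑ k ∈ Finset.range (m + 2), (N.choose k : Polynomial ℤ) * y ^ (m + 1 - k) := by
      rw [Finset.sum_range_succ', Finset.sum_range_succ' _ (m + 1), ← add_assoc,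
        ← Finset.sum_add_distrib]
      congr 1
      · apply Finset.sum_congr rfl
        intro k hk
        rw [Nat.choose_succ_succ, show m + 1 - (k + 1) = m - k by omega]
        push_cast
        ring
      · simp
    rw [e2, e1]
    ring
  have conv : ∀ i N m : ℕ, ∑ k ∈ Finset.range (m + 1), (N.choose k : ℤ) *
      ((Polynomial.X - 1 : Polynomial ℤ) ^ (m - k)).coeff i =
      (∑ k ∈ Finset.range (m + 1), (N.choose k : Polynomial ℤ) *
        (Polynomial.X - 1 : Polynomial ℤ) ^ (m - k)).coeff i := by
    intro i N m
    rw [Polynomial.finsetSum_coeff]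
    apply Finset.sum_congr rfl
    intro k _
    rw [← Polynomial.C_eq_natCast, Polynomial.coeff_C_mul]
    try simp
  induction i with
  | zero =>
    intro N m
    rcases m with _ | m
    · simp
    · rw [conv]
      have := key N m (Polynomial.X - 1)
      rw [show m + 1 + 0 + 1 = m + 2 by omega, show N + 0 + 1 = N + 1 by omega,
        show m + 1 + 0 = m + 1 by omega, this, sub_add_cancel, Polynomial.coeff_add, 
        Polynomial.coeff_X_mul_zero, ← Polynomial.C_eq_natCast, Polynomial.coeff_C_zero]
      simp
  | succ i ih =>
    intro N m
    rw [conv]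
    have := key (N + i + 1) (m + i) (Polynomial.X - 1)
    rw [show m + (i + 1) + 1 = m + i + 2 by omega, show N + (i + 1) + 1 = N + i + 1 + 1 by omega,
      show m + (i + 1) = m + i + 1 by omega, this, sub_add_cancel, Polynomial.coeff_add,
      Polynomial.coeff_X_mul, ← Polynomial.C_eq_natCast, Polynomial.coeff_C_succ, ← conv, ih]
    simp

/-- weight -/
noncomputable def auxG (r i k : ℕ) : ℤ :=
  if k ≤ r then ((Polynomial.X - 1 : Polynomial ℤ) ^ (r - k)).coeff i else 0

theorem auxG_zero (r i k : ℕ) (h : r < i + k) : auxG r i k = 0 := by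
  unfold auxG
  split_ifs with hk
  · apply Polynomial.coeff_eq_zero_of_natDegree_lt
    refine lt_of_le_of_lt Polynomial.natDegree_pow_le ?_
    have : (Polynomial.X - 1 : Polynomial ℤ).natDegree = 1 := by
      simpa using Polynomial.natDegree_X_sub_C (1 : ℤ)
    rw [this]
    omega
  · rfl

theorem aux_sup (r i : ℕ) (C : Finset α) (hr : r < Fintype.card α) :
    ∑ A : Finset α, (if C ⊆ A then auxG r i A.card else 0) =
      zchoose ((Fintype.card α : ℤ) - C.card - i - 1) ((r : ℤ) - i - C.card) := by
  by_cases hc : i + C.card ≤ r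
  · have e1 : ∑ A : Finset α, (if C ⊆ A then auxG r i A.card else 0) =
        ∑ B ∈ (Cᶜ).powerset, auxG r i (C.card + B.card) := by
      rw [← Finset.sum_filter]
      symm
      apply Finset.sum_bij' (fun B _ => C ∪ B) (fun A _ => A \ C)
      · intro B hB; simp
      · intro A hA
        rw [Finset.mem_powerset]
        intro x hx
        simp at hx ⊢
        exact hx.2
      · intro B hB
        rw [Finset.mem_powerset] at hB
        ext x
        have := @hB x
        simp at this ⊢
        tauto
      · intro A hA
        simp at hA
        exact Finset.union_sdiff_of_subset hA
      · intro B hB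
        rw [Finset.mem_powerset] at hB
        rw [Finset.card_union_of_disjoint]
        exact (Finset.disjoint_left.mpr fun x hx hx' => by
          have := hB hx'; simp at this; exact this hx)
    have hcn : C.card ≤ Fintype.card α := Finset.card_le_univ C
    rw [e1, Finset.sum_powerset_apply_card (fun k => auxG r i (C.card + k)), Finset.card_compl]
    obtain ⟨m, hm⟩ : ∃ m, r = C.card + i + m := ⟨r - C.card - i, by omega⟩
    obtain ⟨N, hN⟩ : ∃ N, Fintype.card α = C.card + i + N + 1 :=
      ⟨Fintype.card α - C.card - i - 1, by omega⟩
    have hmN : m ≤ N := by omega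
    have hz : zchoose ((Fintype.card α : ℤ) - C.card - i - 1) ((r : ℤ) - i - C.card)
        = (N.choose m : ℤ) := by
      have a1 : ((Fintype.card α : ℤ) - C.card - i - 1) = (N : ℤ) := by rw [hN]; push_cast; ring
      have a2 : ((r : ℤ) - i - C.card) = (m : ℤ) := by rw [hm]; push_cast; ring
      rw [a1, a2, zchoose, if_pos (by constructor <;> omega)]
      simp
    rw [hz, ← aux_coeff_s8 i N m, show Fintype.card α - C.card = N + i + 1 by omega]
    symm
    have hsub : Finset.range (m + i + 1) ⊆ Finset.range (N + i + 1 + 1) := by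
      apply Finset.range_subset_range.mpr; omega
    rw [← Finset.sum_subset hsub]
    · apply Finset.sum_congr rfl
      intro k hk
      have : k < m + i + 1 := Finset.mem_range.mp hk
      rw [auxG, if_pos (by omega), show r - (C.card + k) = m + i - k by omega]
      simp
    · intro k _ hk
      have : ¬ k < m + i + 1 := fun h => hk (Finset.mem_range.mpr h)
      rw [auxG_zero _ _ _ (by omega)]
      simp
  · rw [zchoose, if_neg (by omega)]
    apply Finset.sum_eq_zero
    intro A _
    split_ifs with h
    · have := Finset.card_le_card h
      exact auxG_zero _ _ _ (by omega)
    · rfl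

namespace FinRankMatroid

theorem aux_null (M : FinRankMatroid α) {A B : Finset α} (h : A ⊆ B) :
    M.rk B + A.card ≤ M.rk A + B.card := by
  have h1 := M.rk_submod A (B \ A)
  rw [Finset.union_sdiff_of_subset h] at h1
  have h2 := M.rk_le_card (B \ A)
  have h3 := Finset.card_sdiff_add_card_eq_card h
  omega

theorem aux_exists (M : FinRankMatroid α) (k : ℕ) (A : Finset α) (h : M.rk A + k ≤ A.card)
    (hk : 0 < k) :
    ∃ B ⊆ A, M.rk B + k = B.card ∧ ∀ e ∈ B, M.rk (B.erase e) = M.rk B := by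
  induction A using Finset.strongInduction with
  | H A ih =>
    by_cases hex : ∃ e ∈ A, M.rk (A.erase e) + k ≤ (A.erase e).card
    · obtain ⟨e, he, h'⟩ := hex
      obtain ⟨B, hB, hB'⟩ := ih _ (Finset.erase_ssubset he) h'
      exact ⟨B, hB.trans (Finset.erase_subset _ _), hB'⟩
    · push Not at hex
      have hne : A.Nonempty := by
        rw [← Finset.card_pos]; omega
      have hall : ∀ e ∈ A, M.rk (A.erase e) = M.rk A ∧ M.rk A + k = A.card := by
        intro e he
        have h1 := hex e he
        have h2 := M.rk_mono (Finset.erase_subset e A)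
        have h3 := Finset.card_erase_add_one he
        omega
      obtain ⟨e, he⟩ := hne
      exact ⟨A, subset_rfl, (hall e he).2, fun e he => (hall e he).1⟩

theorem aux_unique (M : FinRankMatroid α) {A C D : Finset α} (hA : A.card ≤ M.rk A + 1)
    (hC : M.IsCircuit C) (hD : M.IsCircuit D) (hCA : C ⊆ A) (hDA : D ⊆ A) : C ⊆ D := by
  by_contra hcon
  obtain ⟨e, heC, heD⟩ := Finset.not_subset.mp hcon
  have hsub : C ∩ D ⊆ C.erase e := by
    intro x hx
    rw [Finset.mem_inter] at hx
    rw [Finset.mem_erase]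
    exact ⟨fun h => heD (h ▸ hx.2), hx.1⟩
  have h1 := M.aux_null hsub
  have h2 := M.aux_null (Finset.union_subset hCA hDA)
  have h3 := M.rk_submod C D
  have h4 := Finset.card_union_add_card_inter C D
  have h5 := hC.2.2 e heC
  have h6 := Finset.card_erase_add_one heC
  have h7 := hC.2.1
  have h8 := hD.2.1
  omega

end FinRankMatroid

open scoped Classical in
/-- If `d₂ = d_2(M)` is the minimum size of a set `A ∈ D(M)` with `rk(A) = |A| − 2`
(in particular such a set exists), then for every natural number `i` with
`i + d_2(M) > r`,
`[x^i] T_M(x,1) = C(|X|−i−1, r−i) − Σ_{C circuit, |C| < d_2(M)} C(|X|−|C|−i−1, |X|−r−1)`. -/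
theorem stmt_8 (M : FinRankMatroid α) (d2 : ℕ)
    (hd2 : IsLeast {n : ℕ | ∃ A : Finset α,
      M.InDualFlatFamily A ∧ M.rk A + 2 = A.card ∧ A.card = n} d2)
    (i : ℕ) (hi : M.rk Finset.univ < i + d2) :
    (M.tutteXOne).coeff i =
      zchoose ((Fintype.card α : ℤ) - i - 1) ((M.rk Finset.univ : ℤ) - i) -
        ∑ C ∈ Finset.univ.powerset.filter
            (fun C => M.IsCircuit C ∧ C.card < d2),
          zchoose ((Fintype.card α : ℤ) - C.card - i - 1)
            ((Fintype.card α : ℤ) - M.rk Finset.univ - 1) := by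
  have hrn : M.rk Finset.univ + 2 ≤ Fintype.card α := by
    obtain ⟨A, _, hA, _⟩ := hd2.1
    have := M.aux_null (Finset.subset_univ A)
    rw [Finset.card_univ] at this
    omega
  set r := M.rk Finset.univ with hr
  set S := Finset.univ.powerset.filter (fun C => M.IsCircuit C ∧ C.card < d2) with hS
  have hmemS : ∀ C, C ∈ S ↔ M.IsCircuit C ∧ C.card < d2 := by
    intro C; simp [hS]
  have hL : (M.tutteXOne).coeff i =
      ∑ A : Finset α, (if M.rk A = A.card then auxG r i A.card else 0) := by
    rw [FinRankMatroid.tutteXOne, Polynomial.finsetSum_coeff, Finset.powerset_univ,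
      Finset.sum_filter]
    apply Finset.sum_congr rfl
    intro A _
    split_ifs with h
    · have := M.rk_mono (Finset.subset_univ A)
      rw [auxG, if_pos (by omega)]
    · rfl
  have hpt : ∀ A : Finset α, (if M.rk A = A.card then auxG r i A.card else 0) =
      (if ∅ ⊆ A then auxG r i A.card else 0) -
        ∑ C ∈ S, (if C ⊆ A then auxG r i A.card else 0) := by
    intro A
    rw [if_pos (Finset.empty_subset A)]
    by_cases hA : A.card < d2
    · have hle := M.rk_le_card A
      have hn : A.card ≤ M.rk A + 1 := by
        by_contra hcon
        obtain ⟨B, hBA, hB1, hB2⟩ := M.aux_exists 2 A (by omega) (by omega)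
        have h1 := hd2.2 ⟨B, hB2, hB1, rfl⟩
        have h2 := Finset.card_le_card hBA
        omega
      by_cases hi' : M.rk A = A.card
      · rw [if_pos hi', Finset.sum_eq_zero, sub_zero]
        intro C hC
        rw [if_neg]
        intro hCA
        have h1 := M.aux_null hCA
        have h2 := ((hmemS C).1 hC).1.2.1
        omega
      · rw [if_neg hi']
        obtain ⟨B, hBA, hB1, hB2⟩ := M.aux_exists 1 A (by omega) (by omega)
        have hBC : M.IsCircuit B := ⟨by rw [← Finset.card_pos]; omega, hB1, hB2⟩
        have h2 := Finset.card_le_card hBA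
        rw [Finset.sum_eq_single B, if_pos hBA, sub_self]
        · intro C hC hne
          rw [if_neg]
          intro hCA
          have hC' := ((hmemS C).1 hC).1
          exact hne (Finset.Subset.antisymm (M.aux_unique hn hC' hBC hCA hBA)
            (M.aux_unique hn hBC hC' hBA hCA))
        · intro h
          exact absurd ((hmemS B).2 ⟨hBC, by omega⟩) h
    · rw [auxG_zero _ _ _ (by omega)]
      simp
  rw [hL, Finset.sum_congr rfl (fun A _ => hpt A), Finset.sum_sub_distrib, Finset.sum_comm,
    aux_sup r i ∅ (by omega)]
  congr 1
  · simp
  · apply Finset.sum_congr rfl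
    intro C _
    rw [aux_sup r i C (by omega)]
    unfold zchoose
    by_cases hc : i + C.card ≤ r
    · rw [if_pos (by omega), if_pos (by omega)]
      congr 1
      apply Nat.choose_symm_of_eq_add
      omega
    · rw [if_neg (by omega), if_neg (by omega)]
end

section
/- Let M be a matroid on a finite ground set X with rank function rk and rank r = rk(X), and suppose M has at least one circuit, so that d_1(M) is well defined. Then for every natural number i with i ≤ r, the inequality d_1(M) > r − i holds if and only if the coefficient of x^i in T_M(x,1) equals C(|X|−i−1, r−i). -/
variable {α : Type*} [DecidableEq α] [Fintype α]

namespace FinRankMatroid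

theorem rk_union_le (M : FinRankMatroid α) (A B : Finset α) :
    M.rk (A ∪ B) ≤ M.rk A + M.rk B := by
  have := M.rk_submod A B
  omega

theorem rk_insert_le_s9 (M : FinRankMatroid α) (e : α) (A : Finset α) :
    M.rk (insert e A) ≤ M.rk A + M.rk {e} := by
  have := M.rk_union_le {e} A
  rw [← Finset.insert_eq] at this
  omega

theorem rk_singleton_le (M : FinRankMatroid α) (e : α) : M.rk {e} ≤ 1 := by
  simpa using M.rk_le_card {e}

theorem indep_subset (M : FinRankMatroid α) {A B : Finset α} (h : A ⊆ B)
    (hB : M.rk B = B.card) : M.rk A = A.card := by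
  have h1 := M.rk_union_le A (B \ A)
  rw [Finset.union_sdiff_of_subset h] at h1
  have h2 := M.rk_le_card (B \ A)
  have h3 := M.rk_le_card A
  have h4 := Finset.card_sdiff_add_card_eq_card h
  omega

theorem rk_insert_pos (M : FinRankMatroid α) {e : α} (he : M.rk {e} = 1) (A : Finset α) :
    1 ≤ M.rk (insert e A) := by
  rw [← he]
  exact M.rk_mono (by simp)

/-- Contraction of a nonloop. -/
def contr (M : FinRankMatroid α) (e : α) (he : M.rk {e} = 1) : FinRankMatroid α where
  rk A := M.rk (insert e A) - 1
  rk_le_card A := by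
    have := M.rk_insert_le_s9 e A
    have := M.rk_le_card A
    omega
  rk_mono A B h := by
    have := M.rk_mono (Finset.insert_subset_insert e h)
    omega
  rk_submod A B := by
    have h := M.rk_submod (insert e A) (insert e B)
    rw [← Finset.insert_union_distrib, ← Finset.insert_inter_distrib] at h
    have := M.rk_insert_pos he A
    have := M.rk_insert_pos he B
    have := M.rk_insert_pos he (A ∪ B)
    have := M.rk_insert_pos he (A ∩ B)
    omega

/-- The polynomial of the restriction to `S`, with rank parameter `r`. -/
noncomputable def pol (M : FinRankMatroid α) (S : Finset α) (r : ℕ) : Polynomial ℤ :=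
  ∑ A ∈ S.powerset, if M.rk A = A.card then (Polynomial.X - 1) ^ (r - A.card) else 0

theorem pol_coeff_big (M : FinRankMatroid α) (S : Finset α) (r i : ℕ) (h : r < i) :
    (M.pol S r).coeff i = 0 := by
  unfold pol
  rw [Polynomial.finsetSum_coeff]
  apply Finset.sum_eq_zero
  intro A _
  split_ifs
  · apply Polynomial.coeff_eq_zero_of_natDegree_lt
    have : ((Polynomial.X : Polynomial ℤ) - 1).natDegree = 1 := by
      simpa using Polynomial.natDegree_X_sub_C (1 : ℤ)
    rw [Polynomial.natDegree_pow, this]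
    omega
  · simp

theorem pol_nonloop (M : FinRankMatroid α) (e : α) (he : M.rk {e} = 1) (T : Finset α)
    (heT : e ∉ T) (r : ℕ) :
    M.pol (insert e T) (r + 1) = M.pol T (r + 1) + (M.contr e he).pol T r := by
  unfold pol
  rw [Finset.sum_powerset_insert heT]
  congr 1
  apply Finset.sum_congr rfl
  intro A hA
  have hA' : e ∉ A := fun h => heT (Finset.mem_powerset.1 hA h)
  have := M.rk_insert_pos he A
  rw [Finset.card_insert_of_notMem hA']
  have h1 : (M.rk (insert e A) = A.card + 1) ↔ ((M.contr e he).rk A = A.card) := by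
    simp only [contr]
    omega
  simp only [h1, Nat.add_sub_add_right]

theorem pol_loop (M : FinRankMatroid α) (e : α) (he : M.rk {e} = 0) (T : Finset α)
    (heT : e ∉ T) (r : ℕ) :
    M.pol (insert e T) r = M.pol T r := by
  unfold pol
  rw [Finset.sum_powerset_insert heT, add_eq_left]
  apply Finset.sum_eq_zero
  intro A hA
  have hA' : e ∉ A := fun h => heT (Finset.mem_powerset.1 hA h)
  have := M.rk_insert_le_s9 e A
  have := M.rk_le_card A
  rw [Finset.card_insert_of_notMem hA', if_neg (by omega)]

theorem coloop_rk (M : FinRankMatroid α) (e : α) (T A : Finset α) (heT : e ∉ T)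
    (h : M.rk (insert e T) = M.rk T + 1) (hA : A ⊆ T) : M.rk (insert e A) = M.rk A + 1 := by
  have h1 := M.rk_submod T (insert e A)
  have e1 : T ∪ insert e A = insert e T := by
    rw [Finset.union_insert, Finset.union_eq_left.2 hA]
  have e2 : T ∩ insert e A = A := by
    rw [Finset.inter_insert_of_notMem heT, Finset.inter_eq_right.2 hA]
  rw [e1, e2] at h1
  have := M.rk_insert_le_s9 e A
  have := M.rk_singleton_le e
  omega

theorem pol_coloop (M : FinRankMatroid α) (e : α) (T : Finset α)
    (heT : e ∉ T) (h : M.rk (insert e T) = M.rk T + 1) :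
    M.pol (insert e T) (M.rk T + 1) = Polynomial.X * M.pol T (M.rk T) := by
  unfold pol
  rw [Finset.sum_powerset_insert heT, ← Finset.sum_add_distrib, Finset.mul_sum]
  apply Finset.sum_congr rfl
  intro A hA
  have hA0 := Finset.mem_powerset.1 hA
  have hA' : e ∉ A := fun h => heT (hA0 h)
  rw [Finset.card_insert_of_notMem hA', M.coloop_rk e T A heT h hA0]
  simp only [Nat.add_right_cancel_iff, Nat.add_sub_add_right]
  split_ifs with hi
  · have := M.rk_mono hA0
    rw [show M.rk T + 1 - A.card = (M.rk T - A.card) + 1 by omega, pow_succ]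
    ring
  · simp

theorem rk_empty (M : FinRankMatroid α) : M.rk ∅ = 0 := by
  simpa using M.rk_le_card ∅

theorem main (S : Finset α) : ∀ (M : FinRankMatroid α) (i j : ℕ), i + j = M.rk S →
    (M.pol S (M.rk S)).coeff i ≤ (Nat.multichoose (S.card - M.rk S) j : ℤ) ∧
    ((M.pol S (M.rk S)).coeff i = (Nat.multichoose (S.card - M.rk S) j : ℤ) ↔
      ∀ D ⊆ S, D.card ≤ j → M.rk D = D.card) := by
  induction S using Finset.induction_on with
  | empty =>
    intro M i j hij
    rw [M.rk_empty] at hij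
    obtain ⟨rfl, rfl⟩ : i = 0 ∧ j = 0 := by omega
    have h0 : ∀ D ⊆ (∅ : Finset α), D.card ≤ 0 → M.rk D = D.card := by
      intro D hD _
      rw [Finset.subset_empty.1 hD, M.rk_empty, Finset.card_empty]
    have h1 : (M.pol ∅ (M.rk ∅)).coeff 0 = 1 := by
      unfold pol
      rw [Finset.powerset_empty, Finset.sum_singleton, if_pos (by simp [M.rk_empty])]
      simp [M.rk_empty]
    rw [h1, Nat.multichoose_zero_right]
    exact ⟨le_rfl, fun _ => h0, fun _ => rfl⟩
  | insert e T heT ih =>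
    intro M i j hij
    have hc : (insert e T).card = T.card + 1 := Finset.card_insert_of_notMem heT
    have hTc := M.rk_le_card T
    have hmono := M.rk_mono (Finset.subset_insert e T)
    have hins := M.rk_insert_le_s9 e T
    have hs := M.rk_singleton_le e
    rw [hc]
    by_cases he0 : M.rk {e} = 0
    · have hr : M.rk (insert e T) = M.rk T := by omega
      rw [hr] at hij ⊢
      rw [M.pol_loop e he0 T heT]
      obtain ⟨h1, h2⟩ := ih M i j hij
      rw [show T.card + 1 - M.rk T = (T.card - M.rk T) + 1 by omega]
      rcases j with _ | j
      · simp only [Nat.multichoose_zero_right] at h1 h2 ⊢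
        refine ⟨h1, ?_⟩
        rw [h2]
        have hz : ∀ D : Finset α, D.card ≤ 0 → M.rk D = D.card := by
          intro D hD
          have := M.rk_le_card D
          omega
        exact ⟨fun _ D _ => hz D, fun _ D _ => hz D⟩
      · rw [Nat.multichoose_succ_succ]
        have hpos : 0 < Nat.multichoose (T.card - M.rk T + 1) j := by
          rw [Nat.multichoose_eq]
          exact Nat.choose_pos (by omega)
        push_cast
        refine ⟨by omega, ?_⟩
        constructor
        · intro h; omega
        · intro h
          have := h {e} (by simp) (by simp)
          simp [he0] at this
    · have he : M.rk {e} = 1 := by omega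
      by_cases hco : M.rk (insert e T) = M.rk T
      · -- neither loop nor coloop
        have hpos := M.rk_insert_pos he T
        obtain ⟨r, hr⟩ : ∃ r, M.rk (insert e T) = r + 1 := ⟨M.rk (insert e T) - 1, by omega⟩
        have hrT : M.rk T = r + 1 := by omega
        have hrc : (M.contr e he).rk T = r := by simp [contr, hr]
        have hle := M.rk_le_card T
        rw [hr] at hij ⊢
        rw [M.pol_nonloop e he T heT, Polynomial.coeff_add]
        obtain ⟨h1, h2⟩ := ih M i j (by omega)
        rw [hrT] at h1 h2
        rcases j with _ | j
        · rw [pol_coeff_big _ _ _ _ (by omega : r < i), add_zero]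
          simp only [Nat.multichoose_zero_right] at h1 h2 ⊢
          refine ⟨h1, ?_⟩
          rw [h2]
          have hz : ∀ D : Finset α, D.card ≤ 0 → M.rk D = D.card := by
            intro D hD
            have := M.rk_le_card D
            omega
          exact ⟨fun _ D _ => hz D, fun _ D _ => hz D⟩
        · obtain ⟨h3, h4⟩ := ih (M.contr e he) i j (by omega)
          rw [hrc] at h3 h4
          rw [show T.card - r = (T.card - (r+1)) + 1 by omega] at h3 h4
          rw [show T.card + 1 - (r + 1) = (T.card - (r+1)) + 1 by omega,
            Nat.multichoose_succ_succ]
          push_cast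
          refine ⟨by omega, ?_⟩
          have key : ∀ D ⊆ T, ((M.contr e he).rk D = D.card ↔
              M.rk (insert e D) = (insert e D).card) := by
            intro D hD
            rw [Finset.card_insert_of_notMem (fun h => heT (hD h))]
            have := M.rk_insert_pos he D
            simp only [contr]
            omega
          constructor
          · intro h
            have h5 := h2.1 (by omega)
            have h6 := h4.1 (by omega)
            intro D hD hDj
            by_cases heD : e ∈ D
            · have hs : D.erase e ⊆ T := by
                rwa [← Finset.subset_insert_iff]
              have h7 := h6 (D.erase e) hs (by rw [Finset.card_erase_of_mem heD]; omega)
              rwa [key _ hs, Finset.insert_erase heD] at h7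
            · exact h5 D ((Finset.subset_insert_iff_of_notMem heD).1 hD) hDj
          · intro h
            have h5 := h2.2 (fun D hD => h D (hD.trans (Finset.subset_insert e T)))
            have h6 := h4.2 (by
              intro D hD hDj
              rw [key D hD]
              apply h _ (Finset.insert_subset_insert e hD)
              have := Finset.card_insert_le e D
              omega)
            omega
      · have hr : M.rk (insert e T) = M.rk T + 1 := by omega
        rw [hr] at hij ⊢
        rw [M.pol_coloop e T heT hr, Nat.add_sub_add_right]
        have hiff : (∀ D ⊆ insert e T, D.card ≤ j → M.rk D = D.card) ↔
            (∀ D ⊆ T, D.card ≤ j → M.rk D = D.card) := by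
          constructor
          · intro h D hD
            exact h D (hD.trans (Finset.subset_insert e T))
          · intro h D hD hDj
            by_cases heD : e ∈ D
            · have hs : D.erase e ⊆ T := by
                rwa [← Finset.subset_insert_iff]
              have h7 := M.coloop_rk e T _ heT hr hs
              rw [Finset.insert_erase heD] at h7
              have h8 := Finset.card_erase_add_one heD
              have h9 := h (D.erase e) hs (by omega)
              omega
            · exact h D ((Finset.subset_insert_iff_of_notMem heD).1 hD) hDj
        rw [hiff]
        rcases i with _ | i
        · rw [Polynomial.mul_coeff_zero, Polynomial.coeff_X_zero, zero_mul]
          refine ⟨by positivity, ?_⟩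
          obtain rfl : j = M.rk T + 1 := by omega
          constructor
          · intro h
            have h0 : T.card - M.rk T = 0 := by
              by_contra hne
              obtain ⟨c, hc⟩ := Nat.exists_eq_succ_of_ne_zero hne
              have hpos : 0 < Nat.multichoose (T.card - M.rk T) (M.rk T + 1) := by
                rw [Nat.multichoose_eq]
                exact Nat.choose_pos (by omega)
              omega
            intro D hD _
            exact M.indep_subset hD (by omega)
          · intro h
            by_cases h0 : T.card - M.rk T = 0
            · rw [h0]; simp
            · exfalso
              obtain ⟨D, hD, hDc⟩ := Finset.exists_subset_card_eq
                (show M.rk T + 1 ≤ T.card by omega)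
              have := h D hD (by omega)
              have := M.rk_mono hD
              omega
        · rw [Polynomial.coeff_X_mul]
          exact ih M i j (by omega)

theorem exists_circuit (M : FinRankMatroid α) (D : Finset α) (hD : M.rk D ≠ D.card) :
    ∃ C ⊆ D, M.IsCircuit C := by
  induction D using Finset.strongInduction with
  | H D ih =>
    by_cases h : ∃ e ∈ D, M.rk (D.erase e) ≠ (D.erase e).card
    · obtain ⟨e, he, h⟩ := h
      obtain ⟨C, hC, hC'⟩ := ih _ (Finset.erase_ssubset he) h
      exact ⟨C, hC.trans (Finset.erase_subset _ _), hC'⟩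
    · push Not at h
      refine ⟨D, subset_rfl, ?_⟩
      have hle := M.rk_le_card D
      have key : ∀ e ∈ D, M.rk (D.erase e) = M.rk D ∧ M.rk D + 1 = D.card := by
        intro e he
        have h1 := h e he
        have h2 := Finset.card_erase_add_one he
        have h3 := M.rk_mono (Finset.erase_subset e D)
        omega
      have hne : D.Nonempty := by
        rw [Finset.nonempty_iff_ne_empty]
        rintro rfl
        exact hD (by simp [M.rk_empty])
      obtain ⟨e, he⟩ := hne
      exact ⟨⟨e, he⟩, (key e he).2, fun e he => (key e he).1⟩

end FinRankMatroid

/-- If `d₁ = d_1(M)` is the minimum size of a circuit of `M` (in particular `M` has a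
circuit), then for every natural number `i ≤ r`, we have `d_1(M) > r − i` if and only
if `[x^i] T_M(x,1) = C(|X|−i−1, r−i)`. -/
theorem stmt_9 (M : FinRankMatroid α) (d1 : ℕ)
    (hd1 : IsLeast {n : ℕ | ∃ C : Finset α, M.IsCircuit C ∧ C.card = n} d1)
    (i : ℕ) (hi : i ≤ M.rk Finset.univ) :
    M.rk Finset.univ - i < d1 ↔
      (M.tutteXOne).coeff i =
        ((Fintype.card α - i - 1).choose (M.rk Finset.univ - i) : ℤ) := by
  have hmain := (M.main Finset.univ i (M.rk Finset.univ - i) (by omega)).2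
  have hpol : M.tutteXOne = M.pol Finset.univ (M.rk Finset.univ) := by
    unfold FinRankMatroid.tutteXOne FinRankMatroid.pol
    rw [Finset.sum_filter]
  have hle := M.rk_le_card Finset.univ
  rw [hpol]
  rw [Nat.multichoose_eq, Finset.card_univ] at hmain
  rw [Finset.card_univ] at hle
  rw [show Fintype.card α - i - 1
    = Fintype.card α - M.rk Finset.univ + (M.rk Finset.univ - i) - 1 by omega, hmain]
  obtain ⟨⟨C, hC, hCd⟩, hmin⟩ := hd1
  constructor
  · intro h D _ hDc
    by_contra hD
    obtain ⟨C', hC'D, hC'⟩ := M.exists_circuit D hD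
    have h1 := hmin ⟨C', hC', rfl⟩
    have h2 := Finset.card_le_card hC'D
    omega
  · intro h
    by_contra hlt
    have h1 := h C (Finset.subset_univ C) (by omega)
    have h2 := hC.2.1
    omega
end

section
/- Let M be a matroid on a finite ground set X with rank function rk and rank r = rk(X), and let M* be its dual matroid, whose rank function is rk*(A) = |A| + rk(X∖A) − r. Let k be a natural number, and suppose there exists A ∈ D(M) with rk(A) = |A| − k. Then d_k(M) + f_k(M*) = |X|, where f_k(M*) = max{|F| : F a flat of M* with rk*(F) = rk*(X) − k}. -/
variable {α : Type*} [DecidableEq α] [Fintype α]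

/-- The rank function `rk*` of the dual matroid `M*`:
`rk*(A) = |A| + rk(X ∖ A) − r`. -/
def FinRankMatroid.rkStar (M : FinRankMatroid α) (A : Finset α) : ℕ :=
  A.card + M.rk (Finset.univ \ A) - M.rk Finset.univ

/-- `F` is a flat of the dual matroid `M*`: adding any element outside `F` increases
the dual rank. -/
def FinRankMatroid.IsFlatStar (M : FinRankMatroid α) (F : Finset α) : Prop :=
  ∀ e ∉ F, M.rkStar F < M.rkStar (insert e F)

theorem FinRankMatroid.rkStar_add (M : FinRankMatroid α) (A : Finset α) :
    M.rkStar A + M.rk Finset.univ = A.card + M.rk (Finset.univ \ A) := by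
  have h := M.rk_submod A (Finset.univ \ A)
  have h2 := M.rk_le_card A
  rw [Finset.union_sdiff_of_subset (Finset.subset_univ A)] at h
  unfold FinRankMatroid.rkStar
  omega

theorem FinRankMatroid.flat_compl (M : FinRankMatroid α) (A : Finset α) :
    M.IsFlatStar (Finset.univ \ A) ↔ M.InDualFlatFamily A := by
  unfold FinRankMatroid.IsFlatStar FinRankMatroid.InDualFlatFamily
  refine forall_congr' fun e => ?_
  have h0 : e ∉ Finset.univ \ A ↔ e ∈ A := by simp
  rw [h0]
  refine forall_congr' fun he => ?_
  have h1 := M.rkStar_add (Finset.univ \ A)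
  have h2 := M.rkStar_add (insert e (Finset.univ \ A))
  have e1 : Finset.univ \ (Finset.univ \ A) = A := by simp
  have e2 : Finset.univ \ (insert e (Finset.univ \ A)) = A.erase e := by
    ext x; simp
  rw [e1] at h1
  rw [e2, Finset.card_insert_of_notMem (h0.2 he)] at h2
  have h3 := M.rk_mono (Finset.erase_subset e A)
  omega

theorem FinRankMatroid.rank_compl (M : FinRankMatroid α) (k : ℕ) (A : Finset α) :
    M.rkStar (Finset.univ \ A) + k = M.rkStar Finset.univ ↔ M.rk A + k = A.card := by
  have h1 := M.rkStar_add (Finset.univ \ A)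
  have h2 := M.rkStar_add Finset.univ
  have e1 : Finset.univ \ (Finset.univ \ A) = A := by simp
  rw [e1] at h1
  have h3 := M.rk_le_card (Finset.univ \ Finset.univ)
  have h4 : (Finset.univ \ Finset.univ : Finset α).card = 0 := by simp
  have h5 := Finset.card_sdiff_add_card_eq_card (Finset.subset_univ A)
  omega

/-- Suppose there exists `A ∈ D(M)` with `rk(A) = |A| − k`.  Then
`d_k(M) + f_k(M*) = |X|`, where `d_k(M) = min{|A| : A ∈ D(M), rk(A) = |A| − k}` and
`f_k(M*) = max{|F| : F a flat of M* with rk*(F) = rk*(X) − k}` (both of which exist). -/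
theorem stmt_10 (M : FinRankMatroid α) (k : ℕ)
    (h : ∃ A : Finset α, M.InDualFlatFamily A ∧ M.rk A + k = A.card) :
    ∃ d f : ℕ,
      IsLeast {n : ℕ | ∃ A : Finset α,
        M.InDualFlatFamily A ∧ M.rk A + k = A.card ∧ A.card = n} d ∧
      IsGreatest {n : ℕ | ∃ F : Finset α,
        M.IsFlatStar F ∧ M.rkStar F + k = M.rkStar Finset.univ ∧ F.card = n} f ∧
      d + f = Fintype.card α := by
  classical
  have hne : ∃ n, ∃ A : Finset α, M.InDualFlatFamily A ∧ M.rk A + k = A.card ∧ A.card = n := by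
    obtain ⟨A, h1, h2⟩ := h
    exact ⟨_, A, h1, h2, rfl⟩
  obtain ⟨A, h1, h2, h3⟩ := Nat.find_spec hne
  have hc : ∀ B : Finset α, (Finset.univ \ B).card + B.card = Fintype.card α := fun B =>
    Finset.card_sdiff_add_card_eq_card (Finset.subset_univ B)
  have hmin : ∀ B : Finset α, M.InDualFlatFamily B → M.rk B + k = B.card → A.card ≤ B.card := by
    intro B hB hB2
    rw [h3]
    exact Nat.find_min' hne ⟨B, hB, hB2, rfl⟩
  refine ⟨A.card, (Finset.univ \ A).card, ⟨⟨A, h1, h2, rfl⟩, ?_⟩,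
    ⟨⟨_, (M.flat_compl A).2 h1, (M.rank_compl k A).2 h2, rfl⟩, ?_⟩, ?_⟩
  · rintro n ⟨B, hB, hB2, rfl⟩
    exact hmin B hB hB2
  · rintro n ⟨F, hF, hF2, rfl⟩
    have e1 : Finset.univ \ (Finset.univ \ F) = F := by simp
    have := hmin (Finset.univ \ F) ((M.flat_compl _).1 (by rwa [e1]))
      ((M.rank_compl k _).1 (by rwa [e1]))
    have := hc A
    have := hc F
    omega
  · have := hc A
    omega
end

section
/- Let k be a natural number and let G be a (k+1)-edge-connected finite simple graph with vertex set V and edge set E. If S ⊆ E is a set of edges such that the graph G − S obtained by deleting the edges of S has at least 3 connected components, then 2·|S| ≥ 3·(k+1). -/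
/-- A finite simple graph `G` is `(k+1)`-edge-connected if it has at least two
vertices and deleting any set of at most `k` edges leaves it connected. -/
def EdgeConnectedSucc {V : Type*} [Fintype V] [DecidableEq V] (G : SimpleGraph V)
    [DecidableRel G.Adj] (k : ℕ) : Prop :=
  2 ≤ Fintype.card V ∧
    ∀ F : Finset (Sym2 V), F ⊆ G.edgeFinset → F.card ≤ k →
      (G.deleteEdges (F : Set (Sym2 V))).Connected

open Classical in
theorem cut_card_aux {V : Type*} [Fintype V] [DecidableEq V] (k : ℕ) (G : SimpleGraph V)
    [DecidableRel G.Adj] (hG : EdgeConnectedSucc G k) (S : Finset (Sym2 V))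
    (hS : S ⊆ G.edgeFinset)
    (C D : (G.deleteEdges (S : Set (Sym2 V))).ConnectedComponent) (hCD : C ≠ D) :
    k + 1 ≤ (S.filter (fun e =>
      (∃ u ∈ e, (G.deleteEdges (S : Set (Sym2 V))).connectedComponentMk u = C) ∧
      (∃ u ∈ e, (G.deleteEdges (S : Set (Sym2 V))).connectedComponentMk u ≠ C))).card := by
  by_contra hlt
  have hc := hG.2 _ ((Finset.filter_subset _ S).trans hS) (Nat.lt_succ_iff.1 (not_le.1 hlt))
  obtain ⟨a, ha⟩ := C.exists_rep
  obtain ⟨b, hb⟩ := D.exists_rep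
  obtain ⟨w⟩ := hc.preconnected a b
  have key : ∀ x y, ∀ _ : (G.deleteEdges ((S.filter (fun e =>
      (∃ u ∈ e, (G.deleteEdges (S : Set (Sym2 V))).connectedComponentMk u = C) ∧
      (∃ u ∈ e, (G.deleteEdges (S : Set (Sym2 V))).connectedComponentMk u ≠ C)) :
        Finset (Sym2 V)) : Set (Sym2 V))).Walk x y,
      (G.deleteEdges (S : Set (Sym2 V))).connectedComponentMk x = C →
      (G.deleteEdges (S : Set (Sym2 V))).connectedComponentMk y = C := by
    intro x y p
    induction p with
    | nil => exact id
    | @cons u v w h p ih =>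
      intro hu
      apply ih
      by_contra hv
      rw [SimpleGraph.deleteEdges_adj] at h
      by_cases hs : s(u, v) ∈ S
      · apply h.2
        rw [Finset.mem_coe, Finset.mem_filter]
        exact ⟨hs, ⟨u, by simp, hu⟩, ⟨v, by simp, hv⟩⟩
      · apply hv
        rw [← hu, eq_comm]
        apply SimpleGraph.ConnectedComponent.sound
        apply SimpleGraph.Adj.reachable
        rw [SimpleGraph.deleteEdges_adj]
        exact ⟨h.1, by simpa using hs⟩
  exact hCD ((key a b w ha).symm.trans hb)

theorem stmt_11 {V : Type*} [Fintype V] [DecidableEq V] (k : ℕ) (G : SimpleGraph V)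
    [DecidableRel G.Adj] (hG : EdgeConnectedSucc G k) (S : Finset (Sym2 V))
    (hS : S ⊆ G.edgeFinset)
    (h3 : 3 ≤ Nat.card (G.deleteEdges (S : Set (Sym2 V))).ConnectedComponent) :
    3 * (k + 1) ≤ 2 * S.card := by
  classical
  rw [Nat.card_eq_fintype_card] at h3
  obtain ⟨A, B, C, hAB, hAC, hBC⟩ := Fintype.two_lt_card_iff.1 h3
  have h1 := cut_card_aux k G hG S hS A B hAB
  have h2 := cut_card_aux k G hG S hS B C hBC
  have h3 := cut_card_aux k G hG S hS C A hAC.symm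
  rw [Finset.card_filter] at h1 h2 h3
  have hle := Finset.sum_le_card_nsmul S (fun e =>
    (if (∃ u ∈ e, (G.deleteEdges (S : Set (Sym2 V))).connectedComponentMk u = A) ∧
      (∃ u ∈ e, (G.deleteEdges (S : Set (Sym2 V))).connectedComponentMk u ≠ A) then 1 else 0) +
    (if (∃ u ∈ e, (G.deleteEdges (S : Set (Sym2 V))).connectedComponentMk u = B) ∧
      (∃ u ∈ e, (G.deleteEdges (S : Set (Sym2 V))).connectedComponentMk u ≠ B) then 1 else 0) +
    (if (∃ u ∈ e, (G.deleteEdges (S : Set (Sym2 V))).connectedComponentMk u = C) ∧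
      (∃ u ∈ e, (G.deleteEdges (S : Set (Sym2 V))).connectedComponentMk u ≠ C) then 1 else 0)) 2
    (by
      intro e _
      have : ¬ ((∃ u ∈ e, (G.deleteEdges (S : Set (Sym2 V))).connectedComponentMk u = A) ∧
        (∃ u ∈ e, (G.deleteEdges (S : Set (Sym2 V))).connectedComponentMk u = B) ∧
        (∃ u ∈ e, (G.deleteEdges (S : Set (Sym2 V))).connectedComponentMk u = C)) := by
        induction e with
        | _ x y =>
          simp only [Sym2.mem_iff]
          rintro ⟨⟨u, hu, rfl⟩, ⟨v, hv, rfl⟩, ⟨w, hw, rfl⟩⟩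
          rcases hu with rfl | rfl <;> rcases hv with rfl | rfl <;> rcases hw with rfl | rfl <;>
            simp_all
      split_ifs with ha hb hc
      · exact absurd ⟨ha.1, hb.1, hc.1⟩ this
      all_goals omega)
  rw [Finset.sum_add_distrib, Finset.sum_add_distrib, smul_eq_mul] at hle
  omega
end

section
/- Let k be a natural number and let G be a (k+1)-edge-connected finite simple graph with n vertices and m edges, and let g = m − n + 1. Then for every natural number j with j ≤ g and 2·j > 2·g − 3·(k+1), the coefficient of y^j in T_G(1,y) equals C(m−j−1, n−2) − Σ_{i=k+1}^{g−j} C(m−j−i−1, n−2)·|EC_i(G)|. -/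
/-- `S` is a minimal edge cut of `G`: `S ⊆ E(G)`, deleting `S` disconnects `G`, but
deleting any proper subset of `S` leaves `G` connected. -/
def IsMinimalEdgeCut {V : Type*} [Fintype V] [DecidableEq V] (G : SimpleGraph V)
    [DecidableRel G.Adj] (S : Finset (Sym2 V)) : Prop :=
  S ⊆ G.edgeFinset ∧ ¬(G.deleteEdges (S : Set (Sym2 V))).Connected ∧
    ∀ S' : Finset (Sym2 V), S' ⊂ S → (G.deleteEdges (S' : Set (Sym2 V))).Connected

open scoped Classical in
/-- `|EC_i(G)|`: the number of minimal edge cuts of `G` with `i` edges. -/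
noncomputable def numMinimalEdgeCuts {V : Type*} [Fintype V] [DecidableEq V]
    (G : SimpleGraph V) [DecidableRel G.Adj] (i : ℕ) : ℕ :=
  (G.edgeFinset.powerset.filter
    (fun S => IsMinimalEdgeCut G S ∧ S.card = i)).card

open scoped Classical in
/-- `T_G(1, y)` as an integer polynomial in `y`:
`T_G(1,y) = Σ_{A ⊆ E, (V,A) connected} (y − 1)^{|A| − (n−1)}`, where `n = |V|`. -/
noncomputable def graphTutteOneY {V : Type*} [Fintype V] [DecidableEq V]
    (G : SimpleGraph V) [DecidableRel G.Adj] : Polynomial ℤ :=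
  ∑ A ∈ G.edgeFinset.powerset.filter
      (fun A : Finset (Sym2 V) => (SimpleGraph.fromEdgeSet (A : Set (Sym2 V))).Connected),
    (Polynomial.X - 1) ^ (A.card - (Fintype.card V - 1))

/-- Weight of a deleted edge set of size `b`. -/
def wt13 (t j b : ℕ) : ℤ := if b ≤ t then (-1) ^ (t - b) * ((j + (t - b)).choose j : ℤ) else 0

theorem wt13_choose (j c : ℕ) :
    Ring.choose (-((j : ℤ) + 1)) c = (-1) ^ c * ((j + c).choose j : ℤ) := by
  rw [Ring.choose_neg]
  have h : ((j : ℤ) + 1 + (c : ℤ) - 1) = ((j + c : ℕ) : ℤ) := by push_cast; ring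
  have h2 : (j + c).choose c = (j + c).choose j := by
    rw [Nat.choose_symm_add]
  rw [h, Ring.choose_natCast, h2, Units.smul_def, smul_eq_mul, Int.coe_negOnePow_natCast]

theorem wt13_sum {α : Type*} (x : Finset α) (t j : ℕ) (h : j + 1 ≤ x.card) :
    ∑ C ∈ x.powerset, wt13 t j C.card = ((x.card - j - 1).choose t : ℤ) := by
  rw [Finset.sum_powerset_apply_card (wt13 t j)]
  have h1 : ((x.card - j - 1 : ℕ) : ℤ) = (x.card : ℤ) + (-((j : ℤ) + 1)) := by
    omega
  rw [← Ring.choose_natCast, h1, Ring.add_choose_eq _ (Commute.all _ _),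
    Finset.Nat.sum_antidiagonal_eq_sum_range_succ_mk]
  have e1 : ∑ b ∈ Finset.range (x.card + 1), x.card.choose b • wt13 t j b
      = ∑ b ∈ Finset.range (x.card + t + 1), x.card.choose b • wt13 t j b := by
    apply Finset.sum_subset
    · intro b; simp; omega
    · intro b _ hb
      simp at hb
      rw [Nat.choose_eq_zero_of_lt (by omega)]; simp
  have e2 : ∑ b ∈ Finset.range (t + 1), x.card.choose b • wt13 t j b
      = ∑ b ∈ Finset.range (x.card + t + 1), x.card.choose b • wt13 t j b := by
    apply Finset.sum_subset
    · intro b; simp; omega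
    · intro b _ hb
      simp at hb
      rw [wt13, if_neg (by omega)]; simp
  rw [e1, ← e2]
  apply Finset.sum_congr rfl
  intro b hb
  simp at hb
  rw [Ring.choose_natCast, wt13_choose, wt13, if_pos (by omega), nsmul_eq_mul]

theorem wt13_shift {t j i b : ℕ} (h : i ≤ t) : wt13 t j (b + i) = wt13 (t - i) j b := by
  unfold wt13
  have : t - (b + i) = t - i - b := by omega
  rw [this]
  by_cases hb : b + i ≤ t
  · rw [if_pos hb, if_pos (by omega)]
  · rw [if_neg hb, if_neg (by omega)]

theorem wt13_coeff (g j b : ℕ) (hj : j ≤ g) (hb : b ≤ g) :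
    ((Polynomial.X - 1 : Polynomial ℤ) ^ (g - b)).coeff j = wt13 (g - j) j b := by
  have : (Polynomial.X - 1 : Polynomial ℤ) = Polynomial.X + Polynomial.C (-1) := by
    simp [sub_eq_add_neg]
  rw [this, Polynomial.coeff_X_add_C_pow]
  unfold wt13
  by_cases h : b ≤ g - j
  · rw [if_pos h]
    have h1 : g - b - j = g - j - b := by omega
    have h2 : j + (g - j - b) = g - b := by omega
    rw [h1, h2]
  · rw [if_neg h, Nat.choose_eq_zero_of_lt (by omega)]; simp

theorem notConn_of_fun {V : Type*} (H : SimpleGraph V) (f : V → Bool) (a b : V)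
    (hab : f a ≠ f b) (hf : ∀ u v, H.Adj u v → f u = f v) : ¬ H.Connected := by
  intro hc
  obtain ⟨p⟩ := hc.preconnected a b
  apply hab
  clear hab
  induction p with
  | nil => rfl
  | cons h p ih => exact (hf _ _ h).trans ih

theorem exists_fun_of_notConn {V : Type*} [Nonempty V] (H : SimpleGraph V)
    (h : ¬ H.Connected) : ∃ f : V → Bool, (∃ a b, f a ≠ f b) ∧ ∀ u v, H.Adj u v → f u = f v := by
  classical
  have : ¬ H.Preconnected := fun hp => h ((SimpleGraph.connected_iff H).2 ⟨hp, inferInstance⟩)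
  unfold SimpleGraph.Preconnected at this
  push Not at this
  obtain ⟨a, b, hab⟩ := this
  refine ⟨fun v => decide (H.Reachable a v), ⟨a, b, ?_⟩, ?_⟩
  · simp [hab]
  · intro u v huv
    have : H.Reachable a u ↔ H.Reachable a v :=
      ⟨fun h => h.trans huv.reachable, fun h => h.trans huv.symm.reachable⟩
    simp [this]

section
variable {V : Type*} [Fintype V] [DecidableEq V] (G : SimpleGraph V) [DecidableRel G.Adj]

theorem minCut_fun [Nonempty V] {S : Finset (Sym2 V)} (hS : IsMinimalEdgeCut G S) :
    ∃ f : V → Bool, (∃ a b, f a ≠ f b) ∧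
      ∀ u v, G.Adj u v → (s(u, v) ∈ S ↔ f u ≠ f v) := by
  classical
  obtain ⟨hE, hn, hmin⟩ := hS
  obtain ⟨f, ⟨a, b, hab⟩, hf⟩ := exists_fun_of_notConn _ hn
  refine ⟨f, ⟨a, b, hab⟩, ?_⟩
  intro u v huv
  constructor
  · intro hS he
    refine notConn_of_fun _ f a b hab ?_ (hmin (S.erase s(u, v)) (Finset.erase_ssubset hS))
    intro x y hxy
    rw [SimpleGraph.deleteEdges_adj] at hxy
    by_cases hx : s(x, y) = s(u, v)
    · rcases Sym2.eq_iff.1 hx with ⟨rfl, rfl⟩ | ⟨rfl, rfl⟩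
      · exact he
      · exact he.symm
    · apply hf
      rw [SimpleGraph.deleteEdges_adj]
      refine ⟨hxy.1, fun h => hxy.2 ?_⟩
      rw [Finset.mem_coe] at h ⊢
      exact Finset.mem_erase.2 ⟨hx, h⟩
  · intro hne
    by_contra hS
    exact hne (hf u v (by rw [SimpleGraph.deleteEdges_adj]; exact ⟨huv, by simpa using hS⟩))

theorem symmDiff_notConn [Nonempty V] {S T : Finset (Sym2 V)} (hS : IsMinimalEdgeCut G S)
    (hT : IsMinimalEdgeCut G T) (hne : S ≠ T) :
    ¬ (G.deleteEdges ((symmDiff S T : Finset (Sym2 V)) : Set (Sym2 V))).Connected := by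
  obtain ⟨f, -, hf⟩ := minCut_fun G hS
  obtain ⟨g, -, hg⟩ := minCut_fun G hT
  have hex : ∃ a b, (xor (f a) (g a)) ≠ (xor (f b) (g b)) := by
    by_contra hc
    push Not at hc
    apply hne
    ext e
    by_cases he : e ∈ G.edgeFinset
    · induction e with | _ u v =>
      rw [SimpleGraph.mem_edgeFinset, SimpleGraph.mem_edgeSet] at he
      rw [hf u v he, hg u v he]
      have := hc u v
      revert this
      cases f u <;> cases f v <;> cases g u <;> cases g v <;> simp
    · exact ⟨fun h => (he (hS.1 h)).elim, fun h => (he (hT.1 h)).elim⟩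
  obtain ⟨a, b, hab⟩ := hex
  refine notConn_of_fun _ (fun v => xor (f v) (g v)) a b hab ?_
  intro u v huv
  rw [SimpleGraph.deleteEdges_adj, Finset.mem_coe, Finset.mem_symmDiff, hf u v huv.1,
    hg u v huv.1] at huv
  have := huv.2
  revert this
  cases f u <;> cases f v <;> cases g u <;> cases g v <;> simp

theorem exists_minCut {B : Finset (Sym2 V)} (hB : B ⊆ G.edgeFinset)
    (h : ¬ (G.deleteEdges (B : Set (Sym2 V))).Connected) :
    ∃ S ⊆ B, IsMinimalEdgeCut G S := by
  induction B using Finset.strongInduction with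
  | H B ih =>
    by_cases hm : ∀ S' : Finset (Sym2 V), S' ⊂ B →
        (G.deleteEdges (S' : Set (Sym2 V))).Connected
    · exact ⟨B, subset_rfl, hB, h, hm⟩
    · push Not at hm
      obtain ⟨S', h1, h2⟩ := hm
      obtain ⟨S, h3, h4⟩ := ih S' h1 (h1.subset.trans hB) h2
      exact ⟨S, h3.trans h1.subset, h4⟩

variable {G}

theorem minCut_card {k : ℕ} (hG : EdgeConnectedSucc G k) {S : Finset (Sym2 V)}
    (hS : S ⊆ G.edgeFinset) (h : ¬ (G.deleteEdges (S : Set (Sym2 V))).Connected) :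
    k + 1 ≤ S.card := by
  by_contra hc
  exact h (hG.2 S hS (by omega))

open scoped Classical in
theorem conn_indicator {k t : ℕ} (hG : EdgeConnectedSucc G k) (ht : 2 * t < 3 * (k + 1))
    {B : Finset (Sym2 V)} (hB : B ⊆ G.edgeFinset) (hBt : B.card ≤ t) :
    (if (G.deleteEdges (B : Set (Sym2 V))).Connected then (1 : ℤ) else 0) =
      1 - ∑ S ∈ G.edgeFinset.powerset.filter (fun S => IsMinimalEdgeCut G S),
        if S ⊆ B then 1 else 0 := by
  have : Nonempty V := Fintype.card_pos_iff.1 (by have := hG.1; omega)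
  by_cases h : (G.deleteEdges (B : Set (Sym2 V))).Connected
  · rw [if_pos h, Finset.sum_eq_zero]
    · simp
    · intro S hS
      rw [Finset.mem_filter] at hS
      rw [if_neg]
      intro hSB
      exact hS.2.2.1 (h.mono (SimpleGraph.deleteEdges_anti (by exact_mod_cast hSB)))
  · obtain ⟨S, hSB, hS⟩ := exists_minCut G hB h
    rw [if_neg h, Finset.sum_eq_single S]
    · simp [hSB]
    · intro T hT hne
      rw [Finset.mem_filter] at hT
      rw [if_neg]
      intro hTB
      have h1 := minCut_card hG hS.1 hS.2.1
      have h2 := minCut_card hG hT.2.1 hT.2.2.1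
      have h3 := minCut_card hG (S := symmDiff S T)
        (fun e he => by
          rw [Finset.mem_symmDiff] at he
          rcases he with he | he
          · exact hB (hSB he.1)
          · exact hB (hTB he.1))
        (symmDiff_notConn G hS hT.2 hne.symm)
      have h4 : (S ∪ T).card ≤ B.card := Finset.card_le_card (Finset.union_subset hSB hTB)
      have h5 := Finset.card_union_add_card_inter S T
      have h6 : (symmDiff S T).card + (S ∩ T).card = (S ∪ T).card := by
        rw [← Finset.card_union_of_disjoint]
        · congr 1
          ext e; simp [Finset.mem_symmDiff]; tauto
        · rw [Finset.disjoint_left]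
          intro e; simp [Finset.mem_symmDiff]; tauto
      omega
    · intro hn
      exact (hn (by simp [hS]; simpa using hS.1)).elim

theorem sum_superset {α : Type*} [DecidableEq α] (E S : Finset α) (hS : S ⊆ E) (F : ℕ → ℤ) :
    ∑ B ∈ E.powerset, (if S ⊆ B then F B.card else 0) =
      ∑ C ∈ (E \ S).powerset, F (C.card + S.card) := by
  rw [← Finset.sum_filter]
  refine Finset.sum_bij' (fun B _ => B \ S) (fun C _ => C ∪ S) ?_ ?_ ?_ ?_ ?_
  · intro B hB
    simp only [Finset.mem_filter, Finset.mem_powerset] at hB ⊢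
    exact Finset.sdiff_subset_sdiff hB.1 subset_rfl
  · intro C hC
    simp only [Finset.mem_filter, Finset.mem_powerset] at hC ⊢
    exact ⟨Finset.union_subset (hC.trans Finset.sdiff_subset) hS, Finset.subset_union_right⟩
  · intro B hB
    simp only [Finset.mem_filter, Finset.mem_powerset] at hB
    exact Finset.sdiff_union_of_subset hB.2
  · intro C hC
    simp only [Finset.mem_powerset] at hC
    ext e
    have := @hC e
    simp at this ⊢
    tauto
  · intro B hB
    simp only [Finset.mem_filter, Finset.mem_powerset] at hB
    rw [Finset.card_sdiff_add_card_eq_card hB.2]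

theorem fromEdgeSet_sdiff {B : Finset (Sym2 V)} :
    SimpleGraph.fromEdgeSet ((G.edgeFinset \ B : Finset (Sym2 V)) : Set (Sym2 V)) =
      G.deleteEdges (B : Set (Sym2 V)) := by
  ext u v
  simp only [SimpleGraph.fromEdgeSet_adj, SimpleGraph.deleteEdges_adj, Finset.mem_coe,
    Finset.mem_sdiff, SimpleGraph.mem_edgeFinset, SimpleGraph.mem_edgeSet]
  exact ⟨fun h => h.1, fun h => ⟨h, h.1.ne⟩⟩

theorem card_le_of_conn {A : Finset (Sym2 V)}
    (h : (SimpleGraph.fromEdgeSet (A : Set (Sym2 V))).Connected) :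
    Fintype.card V ≤ A.card + 1 := by
  have h1 := h.card_vert_le_card_edgeSet_add_one
  rw [Nat.card_eq_fintype_card] at h1
  have h2 : Nat.card (SimpleGraph.fromEdgeSet (A : Set (Sym2 V))).edgeSet ≤ A.card := by
    rw [Nat.card_coe_set_eq, ← Set.ncard_coe_finset, SimpleGraph.edgeSet_fromEdgeSet]
    exact Set.ncard_le_ncard Set.sdiff_subset (Finset.finite_toSet A)
  omega

open scoped Classical in
theorem coeff_eq (g j : ℕ) (hn : 2 ≤ Fintype.card V)
    (hg : G.edgeFinset.card + 1 = g + Fintype.card V) (hj : j ≤ g) :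
    (graphTutteOneY G).coeff j = ∑ B ∈ G.edgeFinset.powerset,
      wt13 (g - j) j B.card *
        (if (G.deleteEdges (B : Set (Sym2 V))).Connected then (1 : ℤ) else 0) := by
  unfold graphTutteOneY
  rw [Polynomial.finsetSum_coeff, Finset.sum_filter]
  refine Finset.sum_bij' (fun A _ => G.edgeFinset \ A) (fun A _ => G.edgeFinset \ A) ?_ ?_ ?_ ?_ ?_
  · intro A _; simp
  · intro A _; simp
  · intro A hA
    exact Finset.sdiff_sdiff_eq_self (Finset.mem_powerset.1 hA)
  · intro A hA
    exact Finset.sdiff_sdiff_eq_self (Finset.mem_powerset.1 hA)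
  · intro A hA
    have hA := Finset.mem_powerset.1 hA
    have hiff : G.deleteEdges ((G.edgeFinset \ A : Finset (Sym2 V)) : Set (Sym2 V)) =
        SimpleGraph.fromEdgeSet (A : Set (Sym2 V)) := by
      rw [← fromEdgeSet_sdiff, Finset.sdiff_sdiff_eq_self hA]
    by_cases h : (SimpleGraph.fromEdgeSet (A : Set (Sym2 V))).Connected
    · rw [if_pos h, if_pos (hiff ▸ h), mul_one]
      have h1 := card_le_of_conn h
      have h2 := Finset.card_sdiff_add_card_eq_card hA
      rw [← wt13_coeff g j _ hj (by omega)]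
      congr 2
      omega
    · rw [if_neg h, if_neg (hiff ▸ h), mul_zero]

end

/-- Let `G` be a `(k+1)`-edge-connected finite simple graph with `n` vertices and `m`
edges, and let `g = m − n + 1`.  For every natural number `j ≤ g` with
`2j > 2g − 3(k+1)`,
`[y^j] T_G(1,y) = C(m−j−1, n−2) − Σ_{i=k+1}^{g−j} C(m−j−i−1, n−2) |EC_i(G)|`. -/
theorem stmt_13 {V : Type*} [Fintype V] [DecidableEq V] (k : ℕ) (G : SimpleGraph V)
    [DecidableRel G.Adj] (hG : EdgeConnectedSucc G k) (j : ℕ)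
    (hj : j ≤ G.edgeFinset.card + 1 - Fintype.card V)
    (hj2 : 2 * (G.edgeFinset.card + 1 - Fintype.card V) < 2 * j + 3 * (k + 1)) :
    (graphTutteOneY G).coeff j =
      ((G.edgeFinset.card - j - 1).choose (Fintype.card V - 2) : ℤ) -
        ∑ i ∈ Finset.Icc (k + 1) ((G.edgeFinset.card + 1 - Fintype.card V) - j),
          ((G.edgeFinset.card - j - i - 1).choose (Fintype.card V - 2) : ℤ) *
            (numMinimalEdgeCuts G i : ℤ) := by
  classical
  have hn := hG.1
  have hconn : (G.deleteEdges ((∅ : Finset (Sym2 V)) : Set (Sym2 V))).Connected :=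
    hG.2 ∅ (by simp) (by simp)
  rw [← fromEdgeSet_sdiff] at hconn
  have hm := card_le_of_conn hconn
  rw [Finset.sdiff_empty] at hm
  obtain ⟨g, hg⟩ : ∃ g, G.edgeFinset.card + 1 - Fintype.card V = g := ⟨_, rfl⟩
  rw [hg] at hj hj2 ⊢
  have hg' : G.edgeFinset.card + 1 = g + Fintype.card V := by omega
  rw [coeff_eq g j hn hg' hj]
  have step : ∀ B ∈ G.edgeFinset.powerset,
      wt13 (g - j) j B.card *
        (if (G.deleteEdges (B : Set (Sym2 V))).Connected then (1 : ℤ) else 0) =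
      wt13 (g - j) j B.card -
        ∑ S ∈ G.edgeFinset.powerset.filter (fun S => IsMinimalEdgeCut G S),
          if S ⊆ B then wt13 (g - j) j B.card else 0 := by
    intro B hB
    by_cases hBt : B.card ≤ g - j
    · rw [conn_indicator hG (t := g - j) (by omega) (Finset.mem_powerset.1 hB) hBt, mul_sub,
        mul_one, Finset.mul_sum]
      simp only [mul_ite, mul_one, mul_zero]
    · have : wt13 (g - j) j B.card = 0 := by rw [wt13, if_neg hBt]
      simp [this]
  rw [Finset.sum_congr rfl step, Finset.sum_sub_distrib, Finset.sum_comm,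
    wt13_sum _ _ _ (by omega)]
  have hsymm : (G.edgeFinset.card - j - 1).choose (g - j) =
      (G.edgeFinset.card - j - 1).choose (Fintype.card V - 2) :=
    Nat.choose_symm_of_eq_add (by omega)
  rw [hsymm]
  congr 1
  have inner : ∀ S ∈ G.edgeFinset.powerset.filter (fun S => IsMinimalEdgeCut G S),
      (∑ B ∈ G.edgeFinset.powerset, if S ⊆ B then wt13 (g - j) j B.card else 0) =
      if S.card ∈ Finset.Icc (k + 1) (g - j) then
        ((G.edgeFinset.card - j - S.card - 1).choose (Fintype.card V - 2) : ℤ) else 0 := by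
    intro S hS
    rw [Finset.mem_filter, Finset.mem_powerset] at hS
    have hk := minCut_card hG hS.2.1 hS.2.2.1
    rw [sum_superset _ _ hS.1 (wt13 (g - j) j)]
    by_cases hi : S.card ≤ g - j
    · rw [if_pos (Finset.mem_Icc.2 ⟨hk, hi⟩)]
      have hc := Finset.card_sdiff_add_card_eq_card hS.1
      simp only [wt13_shift hi]
      rw [wt13_sum _ _ _ (by omega)]
      have e : (G.edgeFinset \ S).card - j - 1 = G.edgeFinset.card - j - S.card - 1 := by omega
      rw [e]
      congr 1
      exact Nat.choose_symm_of_eq_add (by omega)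
    · rw [if_neg (by simp [hi])]
      apply Finset.sum_eq_zero
      intro C _
      rw [wt13, if_neg (by omega)]
  rw [Finset.sum_congr rfl inner, ← Finset.sum_filter,
    ← Finset.sum_fiberwise_of_maps_to (t := Finset.Icc (k + 1) (g - j)) (g := Finset.card)
      (fun S hS => (Finset.mem_filter.1 hS).2)]
  apply Finset.sum_congr rfl
  intro i hi
  rw [Finset.sum_congr rfl (g := fun _ =>
    ((G.edgeFinset.card - j - i - 1).choose (Fintype.card V - 2) : ℤ))
    (fun S hS => by rw [(Finset.mem_filter.1 hS).2]), Finset.sum_const, nsmul_eq_mul, mul_comm]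
  congr 2
  unfold numMinimalEdgeCuts
  congr 1
  ext S
  simp only [Finset.mem_filter]
  constructor
  · rintro ⟨⟨⟨h1, h2⟩, h3⟩, h4⟩
    exact ⟨h1, h2, h4⟩
  · rintro ⟨h1, h2, h4⟩
    exact ⟨⟨⟨h1, h2⟩, h4 ▸ hi⟩, h4⟩
end

section
/- Let G be a finite simple graph with n vertices, m edges and c connected components, and suppose G contains at least one cycle, so its girth g(G) is finite. Then for every natural number i with i ≤ n − c, the inequality g(G) > n − c − i holds if and only if the coefficient of x^i in T_G(x,1) equals C(m−i−1, n−c−i). -/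
open scoped Classical in
/-- `T_G(x, 1)` as an integer polynomial in `x`:
`T_G(x,1) = Σ_{A ⊆ E, (V,A) acyclic} (x − 1)^{(n−c) − |A|}`, where `n = |V|` and `c`
is the number of connected components of `G`. -/
noncomputable def graphTutteXOne {V : Type*} [Fintype V] [DecidableEq V]
    (G : SimpleGraph V) [DecidableRel G.Adj] : Polynomial ℤ :=
  ∑ A ∈ G.edgeFinset.powerset.filter
      (fun A : Finset (Sym2 V) => (SimpleGraph.fromEdgeSet (A : Set (Sym2 V))).IsAcyclic),
    (Polynomial.X - 1) ^
      ((Fintype.card V - Nat.card G.ConnectedComponent) - A.card)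


/-- Independence complex of a matroid of rank `r`. -/
structure PVMat {α : Type*} [DecidableEq α] (E : Finset α) (F : Finset (Finset α)) (r : ℕ) : Prop where
  sub : ∀ A ∈ F, A ⊆ E
  down : ∀ A ∈ F, ∀ B, B ⊆ A → B ∈ F
  exch : ∀ A ∈ F, ∀ B ∈ F, A.card < B.card → ∃ x ∈ B, x ∉ A ∧ insert x A ∈ F
  le : ∀ A ∈ F, A.card ≤ r
  base : ∃ B ∈ F, B.card = r

namespace PVMat
variable {α : Type*} [DecidableEq α] {E : Finset α} {F : Finset (Finset α)} {r : ℕ}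

lemma extend (h : PVMat E F r) : ∀ (d : ℕ) (A : Finset α), A ∈ F → A.card + d = r →
    ∃ B ∈ F, A ⊆ B ∧ B.card = r := by
  intro d
  induction d with
  | zero => intro A hA hc; exact ⟨A, hA, subset_rfl, by omega⟩
  | succ d ih =>
    intro A hA hc
    obtain ⟨B, hB, hBr⟩ := h.base
    obtain ⟨x, hxB, hxA, hx⟩ := h.exch A hA B hB (by omega)
    obtain ⟨C, hC, hs, hr⟩ := ih _ hx (by rw [Finset.card_insert_of_notMem hxA]; omega)
    exact ⟨C, hC, (Finset.subset_insert _ _).trans hs, hr⟩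

/-- deletion -/
def del (F : Finset (Finset α)) (e : α) : Finset (Finset α) := F.filter (fun A => e ∉ A)
/-- contraction -/
def lnk (F : Finset (Finset α)) (e : α) : Finset (Finset α) :=
  (F.filter (fun A => e ∈ A)).image (fun A => A.erase e)

lemma mem_del {e : α} {A : Finset α} : A ∈ del F e ↔ A ∈ F ∧ e ∉ A := by simp [del]
lemma mem_lnk {e : α} {A : Finset α} : A ∈ lnk F e ↔ insert e A ∈ F ∧ e ∉ A := by
  simp only [lnk, Finset.mem_image, Finset.mem_filter]
  constructor
  · rintro ⟨B, ⟨hB, he⟩, rfl⟩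
    simp [Finset.insert_erase he, hB]
  · rintro ⟨h1, h2⟩
    exact ⟨_, ⟨h1, by simp⟩, by simp [h2]⟩

lemma del_mat (h : PVMat E F r) {e : α} (hb : ∃ B ∈ F, e ∉ B ∧ B.card = r) :
    PVMat (E.erase e) (del F e) r where
  sub A hA := by
    rw [mem_del] at hA
    exact Finset.subset_erase.2 ⟨h.sub A hA.1, hA.2⟩
  down A hA B hB := by
    rw [mem_del] at *
    exact ⟨h.down A hA.1 B hB, fun hh => hA.2 (hB hh)⟩
  exch A hA B hB hc := by
    rw [mem_del] at *
    obtain ⟨x, h1, h2, h3⟩ := h.exch A hA.1 B hB.1 hc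
    refine ⟨x, h1, h2, mem_del.2 ⟨h3, ?_⟩⟩
    rw [Finset.mem_insert]; rintro (rfl | hh)
    · exact hB.2 h1
    · exact hA.2 hh
  le A hA := h.le A (mem_del.1 hA).1
  base := by obtain ⟨B, h1, h2, h3⟩ := hb; exact ⟨B, mem_del.2 ⟨h1, h2⟩, h3⟩

lemma lnk_mat (h : PVMat E F (r+1)) {e : α} (he : {e} ∈ F) :
    PVMat (E.erase e) (lnk F e) r where
  sub A hA := by
    rw [mem_lnk] at hA
    exact Finset.subset_erase.2 ⟨(Finset.subset_insert _ _).trans (h.sub _ hA.1), hA.2⟩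
  down A hA B hB := by
    rw [mem_lnk] at *
    exact ⟨h.down _ hA.1 _ (Finset.insert_subset_insert _ hB), fun hh => hA.2 (hB hh)⟩
  exch A hA B hB hc := by
    rw [mem_lnk] at *
    obtain ⟨x, h1, h2, h3⟩ := h.exch _ hA.1 _ hB.1 (by
      rw [Finset.card_insert_of_notMem hA.2, Finset.card_insert_of_notMem hB.2]; omega)
    simp only [Finset.mem_insert, not_or] at h1 h2
    refine ⟨x, h1.resolve_left h2.1, h2.2, mem_lnk.2 ⟨?_, ?_⟩⟩
    · rwa [Finset.insert_comm]
    · rw [Finset.mem_insert]; rintro (rfl | hh)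
      · exact h2.1 rfl
      · exact hA.2 hh
  le A hA := by
    rw [mem_lnk] at hA
    have := h.le _ hA.1
    rw [Finset.card_insert_of_notMem hA.2] at this; omega
  base := by
    obtain ⟨B, h1, h2, h3⟩ := h.extend r {e} he (by simp; omega)
    have : e ∈ B := h2 (by simp)
    refine ⟨B.erase e, mem_lnk.2 ⟨by rwa [Finset.insert_erase this], by simp⟩, ?_⟩
    rw [Finset.card_erase_of_mem this]; omega

/-- the polynomial -/
noncomputable def poly (F : Finset (Finset α)) (r : ℕ) : Polynomial ℤ :=
  ∑ A ∈ F, (Polynomial.X - 1) ^ (r - A.card)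

lemma poly_rec (F : Finset (Finset α)) (r : ℕ) (e : α) :
    poly F (r+1) = poly (del F e) (r+1) + poly (lnk F e) r := by
  unfold poly
  rw [← Finset.sum_filter_add_sum_filter_not F (fun A => e ∉ A)]
  congr 1
  rw [lnk, Finset.sum_image]
  · simp only [not_not]
    refine Finset.sum_congr rfl fun A hA => ?_
    rw [Finset.mem_filter] at hA
    have : A.card ≠ 0 := by
      rw [Finset.card_ne_zero]; exact ⟨e, hA.2⟩
    rw [Finset.card_erase_of_mem hA.2]
    congr 1; omega
  · intro A hA B hB hAB
    simp only [Finset.coe_filter, Set.mem_ofPred_eq] at hA hB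
    rw [← Finset.insert_erase hA.2, ← Finset.insert_erase hB.2]
    simp only at hAB
    rw [hAB]

lemma poly_coeff_gt (F : Finset (Finset α)) (r i : ℕ) (h : r < i) : (poly F r).coeff i = 0 := by
  unfold poly
  rw [Polynomial.finsetSum_coeff]
  refine Finset.sum_eq_zero fun A _ => ?_
  apply Polynomial.coeff_eq_zero_of_natDegree_lt
  have : (Polynomial.X - 1 : Polynomial ℤ).natDegree = 1 := by
    simpa using Polynomial.natDegree_X_sub_C (1:ℤ)
  refine lt_of_le_of_lt Polynomial.natDegree_pow_le ?_
  rw [this]; omega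

lemma full (E : Finset α) (F : Finset (Finset α)) (r m i j : ℕ) (hm : E.card = m)
    (h : PVMat E F r) (hij : i + j = r) (hr : m ≤ r) :
    (poly F r).coeff i ≤ ((m - i - 1).choose j : ℤ) ∧
    ((poly F r).coeff i = ((m - i - 1).choose j : ℤ) ↔ ∀ A ⊆ E, A.card ≤ j → A ∈ F) := by
  obtain ⟨B, hB, hBr⟩ := h.base
  have hBE := h.sub B hB
  have hEB : B = E := Finset.eq_of_subset_of_card_le hBE (by omega)
  have hrm : m = r := by rw [← hm, ← hBr, hEB]
  subst hEB
  have hF : F = B.powerset := by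
    ext A; rw [Finset.mem_powerset]; exact ⟨h.sub A, h.down B hB A⟩
  have hp : poly F r = Polynomial.X ^ r := by
    have := Finset.sum_pow_mul_eq_add_pow (1 : Polynomial ℤ) (Polynomial.X - 1) B
    rw [poly, hF, ← hBr]
    simpa using this
  have hc : (poly F r).coeff i = ((m - i - 1).choose j : ℤ) := by
    rw [hp, Polynomial.coeff_X_pow, hrm]
    rcases j with _ | j
    · rw [if_pos (by omega)]; simp
    · rw [if_neg (by omega), Nat.choose_eq_zero_of_lt (by omega)]; simp
  refine ⟨hc.le, iff_of_true hc ?_⟩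
  intro A hA _
  exact h.down B hB A hA

lemma main : ∀ (m : ℕ) (E : Finset α) (F : Finset (Finset α)) (r i j : ℕ), E.card = m →
    PVMat E F r → i + j = r →
    (poly F r).coeff i ≤ ((m - i - 1).choose j : ℤ) ∧
    ((poly F r).coeff i = ((m - i - 1).choose j : ℤ) ↔ ∀ A ⊆ E, A.card ≤ j → A ∈ F) := by
  intro m
  induction m with
  | zero =>
    intro E F r i j hm h hij
    exact full E F r 0 i j hm h hij (by omega)
  | succ m ih =>
    intro E F r i j hm h hij
    obtain ⟨B, hB, hBr⟩ := h.base
    have hBE := h.sub B hB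
    rcases Nat.lt_or_ge r (m+1) with hr | hr
    swap
    · exact full E F r (m+1) i j hm h hij hr
    have : B ⊂ E := Finset.ssubset_iff_subset_ne.2 ⟨hBE, by rintro rfl; omega⟩
    obtain ⟨e, heE, heB⟩ := Finset.exists_of_ssubset this
    have hD := h.del_mat ⟨B, hB, heB, hBr⟩
    have hcE : (E.erase e).card = m := by rw [Finset.card_erase_of_mem heE]; omega
    obtain ⟨d1, d2⟩ := ih _ _ r i j hcE hD hij
    by_cases he : {e} ∈ F
    · -- nonloop
      obtain ⟨r, rfl⟩ : ∃ s, r = s + 1 := ⟨r - 1, by have := h.le _ he; simp at this; omega⟩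
      rw [poly_rec F r e, Polynomial.coeff_add]
      rcases j with _ | j
      · rw [poly_coeff_gt _ r i (by omega)]
        have e0 : ∅ ∈ F := h.down _ he _ (by simp)
        simp only [Nat.choose_zero_right, add_zero] at *
        refine ⟨d1, d2.trans ?_⟩
        have e1 : e ∉ (∅ : Finset α) := by simp
        refine iff_of_true ?_ ?_
        · intro A _ hc
          obtain rfl : A = ∅ := Finset.card_eq_zero.1 (by omega)
          exact mem_del.2 ⟨e0, e1⟩
        · intro A _ hc
          obtain rfl : A = ∅ := Finset.card_eq_zero.1 (by omega)
          exact e0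
      · have hL := h.lnk_mat he
        obtain ⟨l1, l2⟩ := ih _ _ r i j hcE hL (by omega)
        have hp : (m + 1 - i - 1).choose (j+1) =
            (m - i - 1).choose j + (m - i - 1).choose (j+1) := by
          rw [← Nat.choose_succ_succ]; congr 1; omega
        rw [hp]
        push_cast
        refine ⟨by linarith, ?_⟩
        have : ∀ a b c d : ℤ, a ≤ c → b ≤ d → (a + b = d + c ↔ a = c ∧ b = d) := by
          intro a b c d h1 h2; constructor
          · intro h; constructor <;> linarith
          · rintro ⟨rfl, rfl⟩; ring
        rw [this _ _ _ _ d1 l1, d2, l2]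
        constructor
        · rintro ⟨h1, h2⟩ A hA hc
          by_cases heA : e ∈ A
          · have := mem_lnk.1 (h2 (A.erase e) (Finset.erase_subset_erase _ hA)
              (by rw [Finset.card_erase_of_mem heA]; omega))
            rw [Finset.insert_erase heA] at this
            exact this.1
          · exact (mem_del.1 (h1 A (Finset.subset_erase.2 ⟨hA, heA⟩) hc)).1
        · intro hh
          constructor
          · intro A hA hc
            rw [Finset.subset_erase] at hA
            exact mem_del.2 ⟨hh A hA.1 hc, hA.2⟩
          · intro A hA hc
            rw [Finset.subset_erase] at hA
            refine mem_lnk.2 ⟨hh _ (Finset.insert_subset heE hA.1) ?_, hA.2⟩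
            rw [Finset.card_insert_of_notMem hA.2]; omega
    · -- loop
      have hFe : del F e = F := by
        ext A
        rw [mem_del]
        refine ⟨fun h => h.1, fun hA => ⟨hA, fun hh => he (h.down A hA _ (by simpa using hh))⟩⟩
      rw [hFe] at d1 d2
      rcases j with _ | j
      · simp only [Nat.choose_zero_right] at *
        have e0 : ∅ ∈ F := h.down _ hB _ (by simp)
        refine ⟨d1, d2.trans ?_⟩
        refine iff_of_true ?_ ?_ <;>
        · intro A _ hc
          obtain rfl : A = ∅ := Finset.card_eq_zero.1 (by omega)
          exact e0
      · have hp : (m + 1 - i - 1).choose (j+1) =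
            (m - i - 1).choose j + (m - i - 1).choose (j+1) := by
          rw [← Nat.choose_succ_succ]; congr 1; omega
        have hpos : 0 < (m - i - 1).choose j := Nat.choose_pos (by omega)
        rw [hp]
        push_cast
        have : (0:ℤ) < (m - i - 1).choose j := by exact_mod_cast hpos
        refine ⟨by linarith, ?_⟩
        constructor
        · intro h; linarith
        · intro hh
          exact absurd (hh {e} (by simpa using heE) (by simp)) he

end PVMat
section
open SimpleGraph

lemma pv_reach {V : Type*} {G : SimpleGraph V} {u v x y : V} (h : (G ⊔ edge u v).Reachable x y) :
    G.Reachable x y ∨ (G.Reachable x u ∧ G.Reachable v y) ∨ (G.Reachable x v ∧ G.Reachable u y) := by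
  obtain ⟨p⟩ := h
  induction p with
  | nil => exact Or.inl (Reachable.refl _)
  | @cons a b c hab p ih =>
    rw [sup_adj, edge_adj] at hab
    rcases hab with hab | ⟨⟨rfl, rfl⟩ | ⟨rfl, rfl⟩, -⟩
    · have := hab.reachable
      rcases ih with h | ⟨h, h'⟩ | ⟨h, h'⟩
      · exact Or.inl (this.trans h)
      · exact Or.inr (Or.inl ⟨this.trans h, h'⟩)
      · exact Or.inr (Or.inr ⟨this.trans h, h'⟩)
    · rcases ih with h | ⟨h, h'⟩ | ⟨h, h'⟩
      · exact Or.inr (Or.inl ⟨Reachable.refl _, h⟩)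
      · exact Or.inr (Or.inl ⟨Reachable.refl _, h'⟩)
      · exact Or.inl h'
    · rcases ih with h | ⟨h, h'⟩ | ⟨h, h'⟩
      · exact Or.inr (Or.inr ⟨Reachable.refl _, h⟩)
      · exact Or.inl h'
      · exact Or.inr (Or.inr ⟨Reachable.refl _, h'⟩)

lemma pv_cc {V : Type*} [Finite V] {G : SimpleGraph V} {u v : V} (h : ¬ G.Reachable u v) :
    Nat.card (G ⊔ edge u v).ConnectedComponent + 1 = Nat.card G.ConnectedComponent := by
  classical
  have hne : u ≠ v := by rintro rfl; exact h (Reachable.refl _)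
  have : Function.Bijective (fun C : {C : G.ConnectedComponent // C ≠ G.connectedComponentMk v} =>
      ConnectedComponent.map (Hom.ofLE (le_sup_left : G ≤ G ⊔ edge u v)) C.1) := by
    constructor
    · rintro ⟨C, hC⟩ ⟨D, hD⟩ hCD
      induction C using ConnectedComponent.ind with | _ x
      induction D using ConnectedComponent.ind with | _ y
      simp only [ConnectedComponent.map_mk, Hom.coe_ofLE, id, ne_eq, ConnectedComponent.eq] at hC hD hCD
      simp only [Subtype.mk.injEq, ConnectedComponent.eq]
      rcases pv_reach hCD with h | h | h
      · exact h
      · exact absurd h.2.symm hD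
      · exact absurd h.1 hC
    · intro C
      induction C using ConnectedComponent.ind with | _ x
      by_cases hx : G.Reachable x v
      · refine ⟨⟨G.connectedComponentMk u, by simpa using h⟩, ?_⟩
        simp only [ConnectedComponent.map_mk, Hom.coe_ofLE, id, ConnectedComponent.eq]
        have h1 : (G ⊔ edge u v).Adj u v := by simp [edge_adj, hne]
        exact h1.reachable.trans (hx.symm.mono le_sup_left)
      · exact ⟨⟨G.connectedComponentMk x, by simpa using hx⟩, rfl⟩
  rw [← Nat.card_congr (Equiv.ofBijective _ this)]
  have := Fintype.ofFinite G.ConnectedComponent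
  rw [Nat.card_eq_fintype_card, Nat.card_eq_fintype_card, Fintype.card_subtype_compl]
  have : 0 < Fintype.card G.ConnectedComponent := Fintype.card_pos_iff.2 ⟨G.connectedComponentMk v⟩
  simp
  omega

lemma pv_insert {V : Type*} (A : Set (Sym2 V)) (u v : V) :
    fromEdgeSet (insert s(u,v) A) = fromEdgeSet A ⊔ edge u v := by
  ext a b
  simp [edge_adj]
  tauto

lemma pv_forest {V : Type*} [Fintype V] [DecidableEq V] (A : Finset (Sym2 V))
    (hd : ∀ e ∈ A, ¬ e.IsDiag) (hA : (fromEdgeSet (A : Set (Sym2 V))).IsAcyclic) :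
    A.card + Nat.card (fromEdgeSet (A : Set (Sym2 V))).ConnectedComponent = Fintype.card V := by
  induction A using Finset.induction_on with
  | empty =>
    simp only [Finset.coe_empty, fromEdgeSet_empty, Finset.card_empty, zero_add]
    rw [← Nat.card_eq_fintype_card]
    refine (Nat.card_congr (Equiv.ofBijective (connectedComponentMk ⊥) ⟨?_, ?_⟩)).symm
    · intro x y h; simpa using h
    · intro C; induction C using ConnectedComponent.ind with | _ x
      exact ⟨x, rfl⟩
  | insert e A he ih =>
    induction e with | _ u v
    rw [Finset.coe_insert, pv_insert] at *
    rw [isAcyclic_sup_fromEdgeSet_iff] at hA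
    have hne : u ≠ v := by simpa using hd s(u,v) (by simp)
    have hr : ¬ (fromEdgeSet (A : Set (Sym2 V))).Reachable u v := by
      intro hr
      rcases hA.2 hr with h | h
      · exact hne h
      · rw [fromEdgeSet_adj] at h
        exact he h.1
    have := ih (fun e he => hd e (by simp [he])) hA.1
    rw [← pv_cc hr] at this
    rw [Finset.card_insert_of_notMem he]; omega

lemma pv_cc_le {V : Type*} [Finite V] {G H : SimpleGraph V} (h : ∀ u v, G.Adj u v → H.Reachable u v) :
    Nat.card H.ConnectedComponent ≤ Nat.card G.ConnectedComponent := by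
  have hr : ∀ u v, G.Reachable u v → H.Reachable u v := by
    rintro u v ⟨p⟩
    induction p with
    | nil => exact Reachable.refl _
    | cons hab p ih => exact (h _ _ hab).trans ih
  refine Nat.card_le_card_of_surjective
    (fun C : G.ConnectedComponent => C.lift (fun v => H.connectedComponentMk v) ?_) ?_
  · intro v w p _; exact ConnectedComponent.sound (hr _ _ ⟨p⟩)
  · intro C
    induction C using ConnectedComponent.ind with | _ x
    exact ⟨G.connectedComponentMk x, rfl⟩

lemma pv_girth {V : Type*} [Fintype V] [DecidableEq V] (G : SimpleGraph V)
    [DecidableRel G.Adj] (hcyc : ¬ G.IsAcyclic) (j : ℕ) :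
    j < G.girth ↔ ∀ A ⊆ G.edgeFinset, A.card ≤ j →
      (fromEdgeSet (A : Set (Sym2 V))).IsAcyclic := by
  constructor
  · intro hj A hA hc a w hw
    have hle : fromEdgeSet (A : Set (Sym2 V)) ≤ G := by
      intro x y hxy
      rw [fromEdgeSet_adj] at hxy
      simpa using hA hxy.1
    have h1 := girth_le_length (hw.mapLe hle)
    rw [Walk.length_map] at h1
    have h2 : w.edges.toFinset ⊆ A := by
      intro e he
      rw [List.mem_toFinset] at he
      have := w.edges_subset_edgeSet he
      rw [edgeSet_fromEdgeSet] at this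
      exact this.1
    have h3 := Finset.card_le_card h2
    rw [List.toFinset_card_of_nodup hw.edges_nodup, Walk.length_edges] at h3
    omega
  · intro h
    by_contra hj
    obtain ⟨a, w, hw, hl⟩ := exists_girth_eq_length.2 hcyc
    have h3 : w.edges.toFinset.card = w.length := by
      rw [List.toFinset_card_of_nodup hw.edges_nodup, Walk.length_edges]
    have h4 : ∀ e ∈ w.edges, e ∈ (fromEdgeSet (w.edges.toFinset : Set (Sym2 V))).edgeSet := by
      intro e he
      rw [edgeSet_fromEdgeSet]
      refine ⟨by simpa using he, ?_⟩
      exact G.not_isDiag_of_mem_edgeSet (w.edges_subset_edgeSet he)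
    refine h w.edges.toFinset ?_ (by omega) (w.transfer _ h4) (hw.transfer h4)
    intro e he
    rw [List.mem_toFinset] at he
    simpa using w.edges_subset_edgeSet he

open scoped Classical in
lemma pv_mat {V : Type*} [Fintype V] [DecidableEq V] (G : SimpleGraph V)
    [DecidableRel G.Adj] :
    PVMat G.edgeFinset (G.edgeFinset.powerset.filter
      (fun A : Finset (Sym2 V) => (SimpleGraph.fromEdgeSet (A : Set (Sym2 V))).IsAcyclic))
      (Fintype.card V - Nat.card G.ConnectedComponent) := by
  have hdiag : ∀ A ⊆ G.edgeFinset, ∀ e ∈ A, ¬ e.IsDiag := by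
    intro A hA e he
    exact G.not_isDiag_of_mem_edgeSet (by simpa using hA he)
  constructor
  · intro A hA
    rw [Finset.mem_filter, Finset.mem_powerset] at hA
    exact hA.1
  · intro A hA B hB
    rw [Finset.mem_filter, Finset.mem_powerset] at *
    exact ⟨hB.trans hA.1, hA.2.anti (fromEdgeSet_mono (by exact_mod_cast hB))⟩
  · intro A hA B hB hc
    rw [Finset.mem_filter, Finset.mem_powerset] at *
    have h1 := pv_forest A (hdiag A hA.1) hA.2
    have h2 := pv_forest B (hdiag B hB.1) hB.2
    by_contra hno
    push Not at hno
    have := pv_cc_le (G := fromEdgeSet (B : Set (Sym2 V))) (H := fromEdgeSet (A : Set (Sym2 V))) (by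
      intro u v huv
      by_contra hr
      rw [fromEdgeSet_adj] at huv
      have hm : s(u,v) ∉ A := by
        intro hh
        exact hr (Adj.reachable (by rw [fromEdgeSet_adj]; exact ⟨hh, huv.2⟩))
      refine hno _ huv.1 hm ?_
      rw [Finset.mem_filter, Finset.mem_powerset, Finset.coe_insert, pv_insert]
      exact ⟨Finset.insert_subset (hB.1 huv.1) hA.1, hA.2.sup_edge_of_not_reachable hr⟩)
    omega
  · intro A hA
    rw [Finset.mem_filter, Finset.mem_powerset] at hA
    have h1 := pv_forest A (hdiag A hA.1) hA.2
    have hle : fromEdgeSet (A : Set (Sym2 V)) ≤ G := by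
      intro x y hxy
      rw [fromEdgeSet_adj] at hxy
      simpa using hA.1 hxy.1
    have := ConnectedComponent.card_le_card_of_le hle
    omega
  · obtain ⟨T, hT, hac, hr⟩ := G.exists_isAcyclic_reachable_eq_le
    have hs : T.edgeFinset ⊆ G.edgeFinset := by
      rw [edgeFinset_subset_edgeFinset]; exact hT
    have hTe : fromEdgeSet (T.edgeFinset : Set (Sym2 V)) = T := by simp
    refine ⟨T.edgeFinset, ?_, ?_⟩
    · rw [Finset.mem_filter, Finset.mem_powerset, hTe]
      exact ⟨hs, hac⟩
    · have h1 := pv_forest T.edgeFinset (hdiag _ hs) (by rw [hTe]; exact hac)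
      rw [hTe] at h1
      have h2 := pv_cc_le (G := G) (H := T) (fun u v h => by rw [hr]; exact h.reachable)
      have h3 := ConnectedComponent.card_le_card_of_le hT
      omega

end

/-- Let `G` be a finite simple graph with `n` vertices, `m` edges and `c` connected
components that contains at least one cycle (so its girth is finite).  Then for every
natural number `i ≤ n − c`, the inequality `girth(G) > n − c − i` holds if and only if
`[x^i] T_G(x,1) = C(m−i−1, n−c−i)`. -/
theorem stmt_14 {V : Type*} [Fintype V] [DecidableEq V] (G : SimpleGraph V)
    [DecidableRel G.Adj] (hcyc : ¬ G.IsAcyclic) (i : ℕ)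
    (hi : i ≤ Fintype.card V - Nat.card G.ConnectedComponent) :
    Fintype.card V - Nat.card G.ConnectedComponent - i < G.girth ↔
      (graphTutteXOne G).coeff i =
        ((G.edgeFinset.card - i - 1).choose
          (Fintype.card V - Nat.card G.ConnectedComponent - i) : ℤ) := by
  rw [pv_girth G hcyc]
  have hm := (PVMat.main _ _ _ _ i (Fintype.card V - Nat.card G.ConnectedComponent - i) rfl
    (pv_mat G) (by omega)).2
  have hp : (graphTutteXOne G) = PVMat.poly _ _ := rfl
  rw [hp]
  refine Iff.trans ?_ hm.symm
  refine forall_congr' fun A => forall_congr' fun hA => forall_congr' fun _ => ?_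
  simp only [Finset.mem_filter, Finset.mem_powerset]
  simp [hA]
end

section
/- Let G be a finite simple graph with n vertices, m edges and c connected components, and suppose there exists at least one edge set A ⊆ E such that every edge of the spanning subgraph (V,A) lies on a cycle of (V,A) and |A| = n − c(A) + 2, where c(A) is the number of connected components of (V,A); let h(G) be the minimum size of such a set A. Then for every natural number i with i > n − c − h(G), the coefficient of x^i in T_G(x,1) equals C(m−i−1, n−c−i) − Σ_{C} C(m−|C|−i−1, m−n+c−1), where the sum is over all edge sets C of cycles of G with |C| < h(G). -/
/-- `C` is the edge set of a cycle of the simple graph `H`. -/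
def IsCycleEdgeSet {V : Type*} [DecidableEq V] (H : SimpleGraph V)
    (C : Finset (Sym2 V)) : Prop :=
  ∃ (u : V) (p : H.Walk u u), p.IsCycle ∧ p.edges.toFinset = C

/-- `A` is an edge set of corank `2` all of whose edges lie on cycles: every edge of
the spanning subgraph `(V, A)` lies on a cycle of `(V, A)`, and
`|A| = n − c(A) + 2` where `c(A)` is the number of connected components of `(V, A)`. -/
def IsCorankTwoCyclic {V : Type*} [Fintype V] [DecidableEq V] (G : SimpleGraph V)
    [DecidableRel G.Adj] (A : Finset (Sym2 V)) : Prop :=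
  A ⊆ G.edgeFinset ∧
    (∀ e ∈ A, ∃ (u : V) (p : (SimpleGraph.fromEdgeSet (A : Set (Sym2 V))).Walk u u),
      p.IsCycle ∧ e ∈ p.edges) ∧
    A.card + Nat.card (SimpleGraph.fromEdgeSet (A : Set (Sym2 V))).ConnectedComponent =
      Fintype.card V + 2

open SimpleGraph in
theorem aux_reach {V : Type*} (H : SimpleGraph V) (u v a b : V)
    (hr : H.Reachable a b) :
    (H.deleteEdges {s(u,v)}).Reachable a b ∨
    ((H.deleteEdges {s(u,v)}).Reachable a u ∧ (H.deleteEdges {s(u,v)}).Reachable v b) ∨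
    ((H.deleteEdges {s(u,v)}).Reachable a v ∧ (H.deleteEdges {s(u,v)}).Reachable u b) := by
  obtain ⟨p⟩ := hr
  induction p with
  | nil => left; rfl
  | @cons x y z hxy p ih =>
    by_cases he : s(x,y) = s(u,v)
    · rw [Sym2.eq_iff] at he
      rcases he with ⟨rfl, rfl⟩ | ⟨rfl, rfl⟩
      · rcases ih with h | ⟨h1, h2⟩ | ⟨h1, h2⟩
        · exact Or.inr (Or.inl ⟨Reachable.refl _, h⟩)
        · exact Or.inr (Or.inl ⟨Reachable.refl _, h2⟩)
        · exact Or.inl h2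
      · rcases ih with h | ⟨h1, h2⟩ | ⟨h1, h2⟩
        · exact Or.inr (Or.inr ⟨Reachable.refl _, h⟩)
        · exact Or.inl h2
        · exact Or.inr (Or.inr ⟨Reachable.refl _, h2⟩)
    · have hxy' : (H.deleteEdges {s(u,v)}).Reachable x y :=
        Adj.reachable (by simp only [deleteEdges_adj, Set.mem_singleton_iff]; exact ⟨hxy, he⟩)
      rcases ih with h | ⟨h1, h2⟩ | ⟨h1, h2⟩
      · exact Or.inl (hxy'.trans h)
      · exact Or.inr (Or.inl ⟨hxy'.trans h1, h2⟩)
      · exact Or.inr (Or.inr ⟨hxy'.trans h1, h2⟩)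

open SimpleGraph in
theorem aux_card_cycle {V : Type*} [Finite V] (H : SimpleGraph V) (u v : V)
    (hr : (H.deleteEdges {s(u,v)}).Reachable u v) :
    Nat.card (H.deleteEdges {s(u,v)}).ConnectedComponent = Nat.card H.ConnectedComponent := by
  apply Nat.card_congr
  refine Equiv.ofBijective (ConnectedComponent.map (Hom.ofLE (deleteEdges_le _))) ⟨?_, ?_⟩
  · intro x y
    refine ConnectedComponent.ind₂ (fun a b hab => ?_) x y
    simp only [ConnectedComponent.map_mk, ConnectedComponent.eq, Hom.coe_ofLE, id] at hab ⊢
    rcases aux_reach H u v a b hab with h | ⟨h1, h2⟩ | ⟨h1, h2⟩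
    · exact h
    · exact h1.trans (hr.trans h2)
    · exact h1.trans (hr.symm.trans h2)
  · exact ConnectedComponent.surjective_map_ofLE _

open SimpleGraph in
theorem aux_card_bridge {V : Type*} [Finite V] (H : SimpleGraph V) (u v : V) (huv : H.Adj u v)
    (hr : ¬ (H.deleteEdges {s(u,v)}).Reachable u v) :
    Nat.card (H.deleteEdges {s(u,v)}).ConnectedComponent = Nat.card H.ConnectedComponent + 1 := by
  classical
  set H' := H.deleteEdges {s(u,v)} with hH'
  set f : H'.ConnectedComponent → H.ConnectedComponent :=
    ConnectedComponent.map (Hom.ofLE (deleteEdges_le _)) with hf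
  have key : Nat.card {x : H'.ConnectedComponent // x ≠ H'.connectedComponentMk v} =
      Nat.card H.ConnectedComponent := by
    apply Nat.card_congr
    refine Equiv.ofBijective (fun x => f x.1) ⟨?_, ?_⟩
    · rintro ⟨x, hx⟩ ⟨y, hy⟩ hab
      revert hx hy hab
      refine ConnectedComponent.ind₂ (fun a b hx hy hab => ?_) x y
      simp only [hf, ConnectedComponent.map_mk, ConnectedComponent.eq, Hom.coe_ofLE, id,
        Subtype.mk.injEq, ne_eq] at hab hx hy ⊢
      rcases aux_reach H u v a b hab with h | ⟨h1, h2⟩ | ⟨h1, h2⟩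
      · exact h
      · exact absurd h2.symm hy
      · exact absurd h1 hx
    · intro y
      refine ConnectedComponent.ind (fun a => ?_) y
      by_cases ha : H'.Reachable a v
      · refine ⟨⟨H'.connectedComponentMk u, ?_⟩, ?_⟩
        · simpa only [ne_eq, ConnectedComponent.eq] using hr
        · simp only [hf, ConnectedComponent.map_mk, ConnectedComponent.eq, Hom.coe_ofLE, id]
          exact huv.reachable.trans (ha.mono (deleteEdges_le _)).symm
      · refine ⟨⟨H'.connectedComponentMk a, ?_⟩, ?_⟩
        · simpa only [ne_eq, ConnectedComponent.eq] using ha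
        · simp only [hf, ConnectedComponent.map_mk, Hom.coe_ofLE, id]
  have := Fintype.ofFinite H'.ConnectedComponent
  rw [← key, Nat.card_eq_fintype_card, Nat.card_eq_fintype_card,
    Fintype.card_subtype_compl, Fintype.card_subtype_eq]
  have : 0 < Fintype.card H'.ConnectedComponent := Fintype.card_pos_iff.2 ⟨H'.connectedComponentMk v⟩
  omega

/-- number of components -/
noncomputable def kap {V : Type*} (A : Finset (Sym2 V)) : ℕ :=
  Nat.card (SimpleGraph.fromEdgeSet (A : Set (Sym2 V))).ConnectedComponent

def OnCyc {V : Type*} (A : Finset (Sym2 V)) (e : Sym2 V) : Prop :=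
  ∃ (u : V) (p : (SimpleGraph.fromEdgeSet (A : Set (Sym2 V))).Walk u u), p.IsCycle ∧ e ∈ p.edges

open SimpleGraph in
theorem aux_erase {V : Type*} [DecidableEq V] (A : Finset (Sym2 V)) (e : Sym2 V) :
    fromEdgeSet ((A.erase e : Finset (Sym2 V)) : Set (Sym2 V)) =
      (fromEdgeSet (A : Set (Sym2 V))).deleteEdges {e} := by
  ext a b
  simp only [fromEdgeSet_adj, deleteEdges_adj, Finset.coe_erase, Set.mem_sdiff,
    Set.mem_singleton_iff]
  tauto

open SimpleGraph in
theorem kap_cycle {V : Type*} [Finite V] [DecidableEq V] (A : Finset (Sym2 V)) (e : Sym2 V)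
    (he : OnCyc A e) : kap (A.erase e) = kap A := by
  unfold kap
  rw [aux_erase]
  induction e with
  | _ u v =>
    exact aux_card_cycle _ u v (adj_and_reachable_delete_edges_iff_exists_cycle.2 he).2

open SimpleGraph in
theorem kap_bridge {V : Type*} [Finite V] [DecidableEq V] (A : Finset (Sym2 V)) (e : Sym2 V)
    (heA : e ∈ A) (hd : ¬ e.IsDiag) (he : ¬ OnCyc A e) : kap (A.erase e) = kap A + 1 := by
  unfold kap
  rw [aux_erase]
  induction e with
  | _ u v =>
    have hadj : (fromEdgeSet (A : Set (Sym2 V))).Adj u v := by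
      rw [fromEdgeSet_adj]; exact ⟨heA, by simpa using hd⟩
    exact aux_card_bridge _ u v hadj
      (fun h => he (adj_and_reachable_delete_edges_iff_exists_cycle.1 ⟨hadj, h⟩))

theorem kap_empty {V : Type*} [Fintype V] : kap (∅ : Finset (Sym2 V)) = Fintype.card V := by
  unfold kap
  rw [← Nat.card_eq_fintype_card]
  simp only [Finset.coe_empty, SimpleGraph.fromEdgeSet_empty]
  refine (Nat.card_congr (Equiv.ofBijective (fun v => SimpleGraph.connectedComponentMk ⊥ v) ⟨?_, ?_⟩)).symm
  · intro a b hab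
    simpa using hab
  · intro y
    exact SimpleGraph.ConnectedComponent.ind (fun a => ⟨a, rfl⟩) y

theorem OnCyc.mem {V : Type*} {A : Finset (Sym2 V)} {e : Sym2 V} (h : OnCyc A e) : e ∈ A := by
  obtain ⟨u, p, _, he⟩ := h
  have := p.edges_subset_edgeSet he
  simp only [SimpleGraph.edgeSet_fromEdgeSet] at this
  exact this.1

theorem OnCyc.mono {V : Type*} {A B : Finset (Sym2 V)} {e : Sym2 V} (h : OnCyc A e)
    (hAB : A ⊆ B) : OnCyc B e := by
  obtain ⟨u, p, hp, he⟩ := h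
  refine ⟨u, p.mapLe (SimpleGraph.fromEdgeSet_mono (by exact_mod_cast hAB)), ?_, ?_⟩
  · simpa using hp
  · simpa using he

/-- nonnegativity of the corank -/
theorem cor_nonneg {V : Type*} [Fintype V] [DecidableEq V] (A : Finset (Sym2 V))
    (hd : ∀ e ∈ A, ¬ e.IsDiag) : Fintype.card V ≤ A.card + kap A := by
  induction A using Finset.strongInduction with
  | _ A ih =>
    rcases A.eq_empty_or_nonempty with rfl | ⟨e, he⟩
    · simp [kap_empty]
    · have h1 := ih _ (Finset.erase_ssubset he) (fun f hf => hd f (Finset.mem_of_mem_erase hf))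
      have h2 := Finset.card_erase_add_one he
      by_cases hc : OnCyc A e
      · rw [kap_cycle A e hc] at h1; omega
      · rw [kap_bridge A e he (hd e he) hc] at h1; omega

theorem cor_mono {V : Type*} [Fintype V] [DecidableEq V] (A B : Finset (Sym2 V))
    (hBA : B ⊆ A)
    (hd : ∀ e ∈ A, ¬ e.IsDiag) : B.card + kap B ≤ A.card + kap A := by
  induction A using Finset.strongInduction with
  | _ A ih =>
    rcases hBA.eq_or_ssubset with rfl | hss
    · rfl
    · obtain ⟨e, he, heB⟩ := Finset.exists_of_ssubset hss
      have h1 := ih _ (Finset.erase_ssubset he) (Finset.subset_erase.2 ⟨hBA, heB⟩)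
        (fun f hf => hd f (Finset.mem_of_mem_erase hf))
      have h2 := Finset.card_erase_add_one he
      by_cases hc : OnCyc A e
      · rw [kap_cycle A e hc] at h1; omega
      · rw [kap_bridge A e he (hd e he) hc] at h1; omega

theorem cor_forest {V : Type*} [Fintype V] [DecidableEq V] (A : Finset (Sym2 V))
    (hd : ∀ e ∈ A, ¬ e.IsDiag) (hac : ∀ e, ¬ OnCyc A e) : A.card + kap A = Fintype.card V := by
  induction A using Finset.strongInduction with
  | _ A ih =>
    rcases A.eq_empty_or_nonempty with rfl | ⟨e, he⟩
    · simp [kap_empty]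
    · have h1 := ih _ (Finset.erase_ssubset he) (fun f hf => hd f (Finset.mem_of_mem_erase hf))
        (fun f hf => hac f (hf.mono (Finset.erase_subset _ _)))
      have h2 := Finset.card_erase_add_one he
      rw [kap_bridge A e he (hd e he) (hac e)] at h1; omega

theorem cor_two {V : Type*} [Fintype V] [DecidableEq V] (A : Finset (Sym2 V))
    (hd : ∀ e ∈ A, ¬ e.IsDiag) (h2 : Fintype.card V + 2 ≤ A.card + kap A) :
    ∃ B ⊆ A, (∀ e ∈ B, OnCyc B e) ∧ B.card + kap B = Fintype.card V + 2 := by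
  induction A using Finset.strongInduction with
  | _ A ih =>
    by_cases hall : (∀ e ∈ A, OnCyc A e) ∧ A.card + kap A = Fintype.card V + 2
    · exact ⟨A, subset_rfl, hall⟩
    · have : ∃ e ∈ A, Fintype.card V + 2 ≤ (A.erase e).card + kap (A.erase e) := by
        by_cases h : ∀ e ∈ A, OnCyc A e
        · have h3 : A.card + kap A ≠ Fintype.card V + 2 := fun h' => hall ⟨h, h'⟩
          have hne : A.Nonempty := by
            rw [Finset.nonempty_iff_ne_empty]
            rintro rfl
            simp [kap_empty] at h2
          obtain ⟨e, he⟩ := hne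
          refine ⟨e, he, ?_⟩
          have := Finset.card_erase_add_one he
          rw [kap_cycle A e (h e he)]; omega
        · push Not at h
          obtain ⟨e, he, hc⟩ := h
          refine ⟨e, he, ?_⟩
          have := Finset.card_erase_add_one he
          rw [kap_bridge A e he (hd e he) hc]; omega
      obtain ⟨e, he, h3⟩ := this
      obtain ⟨B, hB, hB2⟩ := ih _ (Finset.erase_ssubset he)
        (fun f hf => hd f (Finset.mem_of_mem_erase hf)) h3
      exact ⟨B, hB.trans (Finset.erase_subset _ _), hB2⟩

/-- Two distinct cycles give corank at least two. -/
theorem two_cycles {V : Type*} [Fintype V] [DecidableEq V] (A C D : Finset (Sym2 V))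
    (hd : ∀ e ∈ A, ¬ e.IsDiag) (hC : C ⊆ A) (hD : D ⊆ A) (e : Sym2 V) (heC : OnCyc C e)
    (heD : e ∉ D) (f : Sym2 V) (hf : OnCyc D f) :
    Fintype.card V + 2 ≤ A.card + kap A := by
  have h1 := kap_cycle A e (heC.mono hC)
  have hDe : D ⊆ A.erase e := Finset.subset_erase.2 ⟨hD, heD⟩
  have h2 := kap_cycle (A.erase e) f (hf.mono hDe)
  have h3 := Finset.card_erase_add_one (hC heC.mem)
  have h4 := Finset.card_erase_add_one (hDe hf.mem)
  have h5 := cor_nonneg ((A.erase e).erase f)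
    (fun g hg => hd g (Finset.mem_of_mem_erase (Finset.mem_of_mem_erase hg)))
  omega

theorem cyc_onCyc {V : Type*} [DecidableEq V] (G : SimpleGraph V) (C : Finset (Sym2 V))
    (hC : IsCycleEdgeSet G C) (e : Sym2 V) (he : e ∈ C) : OnCyc C e := by
  obtain ⟨u, p, hp, rfl⟩ := hC
  refine ⟨u, p.transfer _ ?_, hp.transfer _, ?_⟩
  · intro e he
    simp only [SimpleGraph.edgeSet_fromEdgeSet]
    exact ⟨by simpa using he, G.not_isDiag_of_mem_edgeSet (p.edges_subset_edgeSet he)⟩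
  · simpa using he

theorem cyc_nonempty {V : Type*} [DecidableEq V] (G : SimpleGraph V) (C : Finset (Sym2 V))
    (hC : IsCycleEdgeSet G C) : C.Nonempty := by
  obtain ⟨u, p, hp, rfl⟩ := hC
  have := hp.three_le_length
  rw [← p.length_edges] at this
  rw [Finset.nonempty_iff_ne_empty, ne_eq, List.toFinset_eq_empty_iff]
  rintro h
  simp [h] at this

theorem onCyc_cyc {V : Type*} [DecidableEq V] (G : SimpleGraph V) (A : Finset (Sym2 V))
    (hA : (A : Set (Sym2 V)) ⊆ G.edgeSet) (u : V)
    (p : (SimpleGraph.fromEdgeSet (A : Set (Sym2 V))).Walk u u) (hp : p.IsCycle) :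
    ∃ C ⊆ A, IsCycleEdgeSet G C := by
  refine ⟨p.edges.toFinset, ?_, u, p.mapLe ?_, ?_, ?_⟩
  · intro e he
    exact OnCyc.mem ⟨u, p, hp, by simpa using he⟩
  · rw [← SimpleGraph.fromEdgeSet_edgeSet G]
    exact SimpleGraph.fromEdgeSet_mono hA
  · simpa using hp
  · simp

/-- For a small edge set, the number of cycles contained in it is `0` or `1`. -/
theorem count_cycles {V : Type*} [Fintype V] [DecidableEq V] (G : SimpleGraph V)
    [DecidableRel G.Adj] (h : ℕ)
    (hh : ∀ A, IsCorankTwoCyclic G A → h ≤ A.card) (A : Finset (Sym2 V))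
    (hA : A ⊆ G.edgeFinset) (hcard : A.card < h) (S : Finset (Finset (Sym2 V)))
    (hS : ∀ C, C ∈ S ↔ C ⊆ G.edgeFinset ∧ IsCycleEdgeSet G C ∧ C.card < h)
    [Decidable (SimpleGraph.fromEdgeSet (A : Set (Sym2 V))).IsAcyclic] :
    (if (SimpleGraph.fromEdgeSet (A : Set (Sym2 V))).IsAcyclic then (1 : ℤ) else 0) =
      1 - ∑ C ∈ S, if C ⊆ A then (1 : ℤ) else 0 := by
  have hd : ∀ e ∈ A, ¬ e.IsDiag := fun e he =>
    G.not_isDiag_of_mem_edgeSet (SimpleGraph.mem_edgeFinset.1 (hA he))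
  split_ifs with hac
  · rw [Finset.sum_eq_zero, sub_zero]
    intro C hC
    rw [if_neg]
    intro hCA
    have hC' := ((hS C).1 hC).2.1
    obtain ⟨e, he⟩ := cyc_nonempty G C hC'
    obtain ⟨u, p, hp, _⟩ := (cyc_onCyc G C hC' e he).mono hCA
    exact hac p hp
  · unfold SimpleGraph.IsAcyclic at hac
    push Not at hac
    obtain ⟨u, p, hp⟩ := hac
    obtain ⟨C, hCA, hC⟩ := onCyc_cyc G A
      (fun e he => SimpleGraph.mem_edgeFinset.1 (hA he)) u p hp
    have hlt : ¬ (Fintype.card V + 2 ≤ A.card + kap A) := by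
      intro h2
      obtain ⟨B, hBA, hB1, hB2⟩ := cor_two A hd h2
      have := hh B ⟨hBA.trans hA, hB1, hB2⟩
      have := Finset.card_le_card hBA
      omega
    have hCS : C ∈ S := (hS C).2 ⟨hCA.trans hA, hC, (Finset.card_le_card hCA).trans_lt hcard⟩
    rw [Finset.sum_eq_single C, if_pos hCA, sub_self]
    · intro D hD hne
      rw [if_neg]
      intro hDA
      apply hlt
      have hD' := ((hS D).1 hD).2.1
      obtain ⟨c, hc⟩ := cyc_nonempty G C hC
      obtain ⟨d, hdd⟩ := cyc_nonempty G D hD'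
      by_cases hsub : D ⊆ C
      · have : ∃ e ∈ C, e ∉ D := Finset.exists_of_ssubset (hsub.ssubset_of_ne hne)
        obtain ⟨e, he, heD⟩ := this
        exact two_cycles A C D hd hCA hDA e (cyc_onCyc G C hC e he) heD d (cyc_onCyc G D hD' d hdd)
      · obtain ⟨e, he, heD⟩ := Finset.not_subset.1 hsub
        exact two_cycles A D C hd hDA hCA e (cyc_onCyc G D hD' e he) heD c (cyc_onCyc G C hC c hc)
    · exact fun h => absurd hCS h

theorem zchoose_symm' (a b : ℤ) : zchoose a (a - b) = zchoose a b := by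
  unfold zchoose
  by_cases h : 0 ≤ b ∧ b ≤ a
  · rw [if_pos h, if_pos (by omega)]
    have h1 : (a - b).toNat = a.toNat - b.toNat := by omega
    rw [h1, Nat.choose_symm (by omega)]
  · rw [if_neg h, if_neg (by omega)]

/-- weight: the coefficient of `x^i` in `(x-1)^(r-k)`, for `k ≤ r` -/
def wt (r i k : ℕ) : ℤ := if k + i ≤ r then (-1) ^ (r - i - k) * ((r - k).choose i : ℤ) else 0

theorem coeff_wt (r i k : ℕ) (hk : k ≤ r) :
    ((Polynomial.X - 1 : Polynomial ℤ) ^ (r - k)).coeff i = wt r i k := by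
  have : (Polynomial.X - 1 : Polynomial ℤ) = Polynomial.X + Polynomial.C (-1) := by
    simp [sub_eq_add_neg]
  rw [this, Polynomial.coeff_X_add_C_pow, wt]
  split_ifs with h
  · rw [show r - k - i = r - i - k by omega]
  · rw [Nat.choose_eq_zero_of_lt (by omega)]; simp

theorem ident_aux (M K i : ℕ) (h : i + 1 ≤ M) :
    ∑ j ∈ Finset.range (K + 1), (M.choose j : ℤ) * ((-1) ^ (K - j) * ((K - j + i).choose i : ℤ)) =
      ((M - i - 1).choose K : ℤ) := by
  have h1 := Ring.add_choose_eq (R := ℤ) (r := (M : ℤ)) (s := -((i + 1 : ℕ) : ℤ)) K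
    (Commute.all _ _)
  have h2 : (M : ℤ) + -((i + 1 : ℕ) : ℤ) = ((M - i - 1 : ℕ) : ℤ) := by omega
  rw [h2, Ring.choose_natCast, Finset.Nat.sum_antidiagonal_eq_sum_range_succ
    (fun a b => Ring.choose (M : ℤ) a * Ring.choose (-((i + 1 : ℕ) : ℤ)) b)] at h1
  rw [h1]
  refine Finset.sum_congr rfl fun j hj => ?_
  rw [Ring.choose_natCast, Ring.choose_neg]
  have h3 : ((i + 1 : ℕ) : ℤ) + ((K - j : ℕ) : ℤ) - 1 = ((K - j + i : ℕ) : ℤ) := by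
    push_cast; ring
  rw [h3, Ring.choose_natCast, Nat.choose_symm_add]
  congr 1

theorem ident (M R i : ℕ) (h : R < M) (hi : i ≤ R) :
    ∑ j ∈ Finset.range (M + 1), M.choose j • wt R i j = ((M - i - 1).choose (R - i) : ℤ) := by
  rw [← ident_aux M (R - i) i (by omega)]
  symm
  apply Finset.sum_subset_zero_on_sdiff
  · intro x; simp only [Finset.mem_range]; omega
  · intro x hx
    simp only [Finset.mem_sdiff, Finset.mem_range] at hx
    rw [wt, if_neg (by omega), smul_zero]
  · intro x hx
    simp only [Finset.mem_range] at hx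
    rw [wt, if_pos (by omega), nsmul_eq_mul, show R - i - x + i = R - x by omega]

theorem sum_super {α : Type*} [DecidableEq α] (E C : Finset α) (hC : C ⊆ E) (r i : ℕ)
    (hr : r < E.card) :
    ∑ A ∈ E.powerset, (if C ⊆ A then wt r i A.card else 0) =
      zchoose ((E.card : ℤ) - C.card - i - 1) ((E.card : ℤ) - r - 1) := by
  have hm := Finset.card_le_card hC
  have h1 : ∑ A ∈ E.powerset, (if C ⊆ A then wt r i A.card else 0) =
      ∑ B ∈ (E \ C).powerset, wt r i (C.card + B.card) := by
    rw [← Finset.sum_filter]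
    refine Finset.sum_nbij' (fun A => A \ C) (fun B => C ∪ B) ?_ ?_ ?_ ?_ ?_
    · intro A hA
      simp only [Finset.mem_filter, Finset.mem_powerset] at hA ⊢
      exact Finset.sdiff_subset_sdiff hA.1 subset_rfl
    · intro B hB
      simp only [Finset.mem_filter, Finset.mem_powerset] at hB ⊢
      exact ⟨Finset.union_subset hC (hB.trans Finset.sdiff_subset), Finset.subset_union_left⟩
    · intro A hA
      simp only [Finset.mem_filter, Finset.mem_powerset] at hA ⊢
      exact Finset.union_sdiff_of_subset hA.2
    · intro B hB
      simp only [Finset.mem_powerset] at hB ⊢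
      ext x
      have := @hB x
      simp only [Finset.mem_sdiff, Finset.mem_union] at this ⊢
      tauto
    · intro A hA
      simp only [Finset.mem_filter, Finset.mem_powerset] at hA ⊢
      rw [Finset.card_sdiff_of_subset hA.2, Nat.add_sub_cancel' (Finset.card_le_card hA.2)]
  rw [h1, Finset.sum_powerset_apply_card (fun k => wt r i (C.card + k)),
    Finset.card_sdiff_of_subset hC]
  by_cases hci : C.card + i ≤ r
  · have h2 : ∀ k, wt r i (C.card + k) = wt (r - C.card) i k := by
      intro k
      unfold wt
      by_cases hk : C.card + k + i ≤ r
      · rw [if_pos hk, if_pos (by omega)]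
        congr 2
        · omega
        · congr 1; omega
      · rw [if_neg hk, if_neg (by omega)]
    simp only [h2]
    rw [ident _ _ _ (by omega) (by omega), zchoose, if_pos (by omega)]
    rw [← Nat.choose_symm (by omega)]
    congr 2 <;> omega
  · rw [zchoose, if_neg (by omega)]
    refine Finset.sum_eq_zero fun k _ => ?_
    rw [wt, if_neg (by omega), smul_zero]

open scoped Classical in
/-- Let `G` be a finite simple graph with `n` vertices, `m` edges and `c` connected
components, and let `h = h(G)` be the minimum size of an edge set `A` all of whose
edges lie on cycles of `(V,A)` and with `|A| = n − c(A) + 2` (such a set being assumed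
to exist).  Then for every natural number `i > n − c − h(G)`,
`[x^i] T_G(x,1) = C(m−i−1, n−c−i) − Σ_{C cycle of G, |C| < h(G)} C(m−|C|−i−1, m−n+c−1)`. -/
theorem stmt_15 {V : Type*} [Fintype V] [DecidableEq V] (G : SimpleGraph V)
    [DecidableRel G.Adj] (h : ℕ)
    (hh : IsLeast {s : ℕ | ∃ A : Finset (Sym2 V), IsCorankTwoCyclic G A ∧ A.card = s} h)
    (i : ℕ)
    (hi : (Fintype.card V : ℤ) - Nat.card G.ConnectedComponent - h < (i : ℤ)) :
    (graphTutteXOne G).coeff i =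
      zchoose ((G.edgeFinset.card : ℤ) - i - 1)
          ((Fintype.card V : ℤ) - Nat.card G.ConnectedComponent - i) -
        ∑ C ∈ G.edgeFinset.powerset.filter
            (fun C => IsCycleEdgeSet G C ∧ C.card < h),
          zchoose ((G.edgeFinset.card : ℤ) - C.card - i - 1)
            ((G.edgeFinset.card : ℤ) - Fintype.card V +
              Nat.card G.ConnectedComponent - 1) := by
  set E := G.edgeFinset with hE
  set S := E.powerset.filter (fun C => IsCycleEdgeSet G C ∧ C.card < h) with hSdef
  have hS : ∀ C, C ∈ S ↔ C ⊆ G.edgeFinset ∧ IsCycleEdgeSet G C ∧ C.card < h := by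
    intro C
    simp only [hSdef, Finset.mem_filter, Finset.mem_powerset, hE]
  have hdiag : ∀ A ⊆ E, ∀ e ∈ A, ¬ e.IsDiag := fun A hA e he =>
    G.not_isDiag_of_mem_edgeSet (SimpleGraph.mem_edgeFinset.1 (hA he))
  have hkE : kap E = Nat.card G.ConnectedComponent := by
    unfold kap
    rw [hE, SimpleGraph.coe_edgeFinset, SimpleGraph.fromEdgeSet_edgeSet]
  have hle : ∀ A, IsCorankTwoCyclic G A → h ≤ A.card := fun A hA => hh.2 ⟨A, hA, rfl⟩
  obtain ⟨⟨A₀, hA₀, hA₀h⟩, -⟩ := hh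
  have hm : Fintype.card V + 2 ≤ E.card + kap E := by
    have := cor_mono E A₀ hA₀.1 (hdiag E subset_rfl)
    have h2 : A₀.card + kap A₀ = Fintype.card V + 2 := hA₀.2.2
    omega
  have hcn : kap E ≤ Fintype.card V := by
    rw [← kap_empty]
    exact SimpleGraph.ConnectedComponent.card_le_card_of_le
      (SimpleGraph.fromEdgeSet_mono (by simp))
  rw [← hkE] at hi ⊢
  obtain ⟨r, hr⟩ : ∃ r, r = Fintype.card V - kap E := ⟨_, rfl⟩
  have hrm : r < E.card := by omega
  have hT : (graphTutteXOne G).coeff i = ∑ A ∈ E.powerset,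
      (wt r i A.card - ∑ C ∈ S, if C ⊆ A then wt r i A.card else 0) := by
    unfold graphTutteXOne
    rw [Polynomial.finsetSum_coeff, Finset.sum_filter]
    refine Finset.sum_congr rfl fun A hA => ?_
    rw [Finset.mem_powerset] at hA
    have e1 : (if (SimpleGraph.fromEdgeSet (A : Set (Sym2 V))).IsAcyclic then
        ((Polynomial.X - 1 : Polynomial ℤ) ^
          ((Fintype.card V - Nat.card G.ConnectedComponent) - A.card)).coeff i else 0) =
        (if (SimpleGraph.fromEdgeSet (A : Set (Sym2 V))).IsAcyclic then (1 : ℤ) else 0) *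
          wt r i A.card := by
      split_ifs with hac
      · rw [one_mul, ← hkE, ← hr, coeff_wt]
        have h1 := cor_forest A (hdiag A hA) (fun e ⟨u, p, hp, _⟩ => hac p hp)
        have h2 : kap E ≤ kap A := SimpleGraph.ConnectedComponent.card_le_card_of_le
          (SimpleGraph.fromEdgeSet_mono (by exact_mod_cast hA))
        omega
      · rw [zero_mul]
    rw [e1]
    by_cases hAi : A.card + i ≤ r
    · rw [count_cycles G h hle A hA (by omega) S hS, sub_mul, one_mul, Finset.sum_mul]
      congr 1
      refine Finset.sum_congr rfl fun C _ => ?_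
      split_ifs <;> simp
    · have : wt r i A.card = 0 := by rw [wt, if_neg hAi]
      simp [this]
  rw [hT, Finset.sum_sub_distrib, Finset.sum_comm]
  congr 1
  · have := sum_super E ∅ (Finset.empty_subset _) r i hrm
    simp only [Finset.empty_subset, if_true, Finset.card_empty, Nat.cast_zero, sub_zero] at this
    rw [this, ← zchoose_symm']
    congr 1
    omega
  · refine Finset.sum_congr rfl fun C hC => ?_
    rw [sum_super E C ((hS C).1 hC).1 r i hrm]
    congr 1
    omega
end
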